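/- arXiv:2208.11787 — 8 statements merged into one kernel-verified Lean document; each statement's English description precedes it below -/
import Mathlib

section
/- Let n = 2κ+1 and let x_1, …, x_n ∈ ℝ. Let x_m be a median of the instance, i.e., at least κ+1 indices i satisfy x_i ≤ x_m and at least κ+1 indices i satisfy x_i ≥ x_m. Let x ∈ ℝ with x ≥ x_m, let m' = #{i : x_m ≤ x_i < x}, and assume m' ≤ κ. Then (i) SC(x) ≤ SC(x_m) + 2·m'·(x − x_m); (ii) SC(x_m) ≥ (κ+1−m')·(x − x_m); and consequently (iii) SC(x) ≤ SC(x_m)·(1 + 2m'/(κ+1−m')). -/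
/-- The social cost of a point `y` w.r.t. points `x 1, …, x n` on the line. -/
noncomputable def socialCost {n : ℕ} (x : Fin n → ℝ) (y : ℝ) : ℝ := ∑ i, |x i - y|

/-- Sensitivity of the median's social cost: with `n = 2κ+1` agents, a median `x_m`,
a point `p ≥ x_m`, and `m' = #{i : x_m ≤ x i < p}` agents between them (`m' ≤ κ`),
(i) `SC(p) ≤ SC(x_m) + 2 m' (p - x_m)`, (ii) `SC(x_m) ≥ (κ+1-m')(p - x_m)`, and
(iii) `SC(p) ≤ SC(x_m) (1 + 2m'/(κ+1-m'))`. -/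
theorem stmt_0 (κ : ℕ) (x : Fin (2 * κ + 1) → ℝ) (xm p : ℝ)
    (hmed₁ : κ + 1 ≤ (Finset.univ.filter fun i => x i ≤ xm).card)
    (hmed₂ : κ + 1 ≤ (Finset.univ.filter fun i => xm ≤ x i).card)
    (hp : xm ≤ p)
    (m' : ℕ) (hm' : m' = (Finset.univ.filter fun i => xm ≤ x i ∧ x i < p).card)
    (hm'κ : m' ≤ κ) :
    socialCost x p ≤ socialCost x xm + 2 * m' * (p - xm) ∧
    ((κ : ℝ) + 1 - m') * (p - xm) ≤ socialCost x xm ∧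
    socialCost x p ≤ socialCost x xm * (1 + 2 * m' / ((κ : ℝ) + 1 - m')) := by
  set A := Finset.univ.filter fun i => xm ≤ x i
  set M := Finset.univ.filter fun i => xm ≤ x i ∧ x i < p
  have card_A : (κ : ℝ) + 1 ≤ A.card := by exact_mod_cast hmed₂
  have sum_A : ∑ i, (if xm ≤ x i then (1 : ℝ) else 0) = A.card := by
    simp [A, Finset.sum_boole]
  have sum_M : ∑ i, (if xm ≤ x i ∧ x i < p then (1 : ℝ) else 0) = m' := by
    rw [hm', Finset.sum_boole]
  have d_nonneg : 0 ≤ p - xm := sub_nonneg.2 hp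
  have upper : socialCost x p ≤ socialCost x xm + 2 * m' * (p - xm) := by
    have key : socialCost x p ≤ ∑ i, (|x i - xm| + (p - xm) *
        (1 + 2 * (if xm ≤ x i ∧ x i < p then (1 : ℝ) else 0)
          - 2 * (if xm ≤ x i then (1 : ℝ) else 0))) := by
      refine Finset.sum_le_sum fun i _ => ?_
      split_ifs <;> grind
    rw [Finset.sum_add_distrib, ← Finset.mul_sum, Finset.sum_sub_distrib, Finset.sum_add_distrib,
      ← Finset.mul_sum, ← Finset.mul_sum, sum_A, sum_M] at key
    simp only [Finset.sum_const, Finset.card_univ, Fintype.card_fin, nsmul_eq_mul, mul_one] at key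
    push_cast at key
    unfold socialCost at key ⊢
    nlinarith [mul_le_mul_of_nonneg_left card_A d_nonneg]
  have lower : ((κ : ℝ) + 1 - m') * (p - xm) ≤ socialCost x xm := by
    have key : ∑ i, (p - xm) * ((if xm ≤ x i then (1 : ℝ) else 0)
        - (if xm ≤ x i ∧ x i < p then (1 : ℝ) else 0)) ≤ socialCost x xm := by
      refine Finset.sum_le_sum fun i _ => ?_
      split_ifs <;> grind
    rw [← Finset.mul_sum, Finset.sum_sub_distrib, sum_A, sum_M] at key
    nlinarith [mul_le_mul_of_nonneg_left card_A d_nonneg]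
  refine ⟨upper, lower, upper.trans ?_⟩
  have pos : (0 : ℝ) < (κ : ℝ) + 1 - m' := by
    have : (m' : ℝ) ≤ κ := by exact_mod_cast hm'κ
    linarith
  have dist_le : p - xm ≤ socialCost x xm / ((κ : ℝ) + 1 - m') := by
    rw [le_div_iff₀ pos]
    linarith
  calc socialCost x xm + 2 * m' * (p - xm)
      ≤ socialCost x xm + 2 * m' * (socialCost x xm / ((κ : ℝ) + 1 - m')) := by gcongr
    _ = socialCost x xm * (1 + 2 * m' / ((κ : ℝ) + 1 - m')) := by ring
end

section
/- Fix ρ ∈ ℕ and x ∈ (−1, 1). Then lim_{κ→∞} ( ∑_{i=−κ}^{⌊xκ⌋} binom(κ−i, ρ)·binom(κ+i, ρ) ) / binom(2κ+1, 2ρ+1) = C(ρ) · ∫_{−1}^{x} (1−t²)^ρ dt, where C(ρ) = (2ρ+1)! / ((ρ!)² · 2^{2ρ+1}). Equivalently, the (κ, ρ)-Vandermonde distribution (the law of the normalized median rank of a random (2ρ+1)-subset of 2κ+1 ordered points) converges as κ → ∞ to the continuous distribution on [−1, 1] with density φ(t) = C(ρ)(1−t²)^ρ. -/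
open Filter

/-- The normalizing constant `C(ρ) = (2ρ+1)! / ((ρ!)² · 2^{2ρ+1})`. -/
noncomputable def vandermondeC (ρ : ℕ) : ℝ :=
  (Nat.factorial (2 * ρ + 1)) / ((Nat.factorial ρ) ^ 2 * 2 ^ (2 * ρ + 1))

open MeasureTheory Topology

/-- If `n κ ∼ c κ`, then `binom(n κ, ρ) ∼ c ^ ρ κ ^ ρ / ρ!`. -/
theorem tendsto_choose_div_pow {n : ℕ → ℕ} {c : ℝ}
    (h : Tendsto (fun κ : ℕ => (n κ : ℝ) / κ) atTop (𝓝 c)) (ρ : ℕ) :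
    Tendsto (fun κ : ℕ => ((n κ).choose ρ : ℝ) / (κ : ℝ) ^ ρ) atTop
      (𝓝 (c ^ ρ / ρ.factorial)) := by
  induction ρ with
  | zero => simp
  | succ ρ ih =>
    have h₁ : Tendsto (fun κ : ℕ => (n κ : ℝ) / κ - (ρ : ℝ) / κ) atTop (𝓝 c) := by
      simpa using h.sub (tendsto_const_div_atTop_nhds_zero_nat (ρ : ℝ))
    convert (ih.mul h₁).div_const ((ρ : ℝ) + 1) using 1
    · ext κ
      have key : ((n κ).choose (ρ + 1) : ℝ) * (ρ + 1) = (n κ).choose ρ * (n κ - ρ) := by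
        rcases le_or_gt ρ (n κ) with hle | hlt
        · have := Nat.choose_succ_right_eq (n κ) ρ
          rw [← Nat.cast_sub hle]
          exact_mod_cast this
        · simp [Nat.choose_eq_zero_of_lt hlt, Nat.choose_eq_zero_of_lt (hlt.trans ρ.lt_succ_self)]
      rw [eq_div_iff (by positivity), div_mul_eq_mul_div, key, ← sub_div, pow_succ,
        mul_div_mul_comm]
    · rw [Nat.factorial_succ, pow_succ]
      push_cast
      congr 1
      field_simp

/-- The function `t ↦ ⌊t κ⌋ / κ` converges pointwise to the identity. -/
theorem tendsto_floor_mul_natCast_div (t : ℝ) :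
    Tendsto (fun κ : ℕ => (⌊t * κ⌋ : ℝ) / κ) atTop (𝓝 t) := by
  have h : Tendsto (fun κ : ℕ => t - 1 / (κ : ℝ)) atTop (𝓝 t) := by
    simpa using tendsto_const_nhds.sub (tendsto_const_div_atTop_nhds_zero_nat (1 : ℝ))
  refine tendsto_of_tendsto_of_tendsto_of_le_of_le' h tendsto_const_nhds ?_ ?_ <;>
    filter_upwards [eventually_gt_atTop 0] with κ hκ
  all_goals have hκ' : (0 : ℝ) < κ := by exact_mod_cast hκ
  · rw [le_div_iff₀ hκ', sub_mul, one_div, inv_mul_cancel₀ hκ'.ne']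
    exact (Int.sub_one_lt_floor _).le
  · rw [div_le_iff₀ hκ']
    exact Int.floor_le _

theorem intervalIntegrable_comp_floor_unit (F : ℤ → ℝ) (m : ℤ) :
    IntervalIntegrable (fun s : ℝ => F ⌊s⌋) volume m (m + 1) := by
  refine (intervalIntegrable_const (c := F m)).congr_uIoo fun s hs => ?_
  rw [Set.uIoo_of_le (by linarith)] at hs
  simp only [(Int.floor_eq_iff).2 ⟨hs.1.le, hs.2⟩]

theorem intervalIntegrable_comp_floor_and_sum_eq_integral (F : ℤ → ℝ) {m n : ℤ} (h : m ≤ n) :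
    IntervalIntegrable (fun s : ℝ => F ⌊s⌋) volume m n ∧
      ∑ i ∈ Finset.Ico m n, F i = ∫ s in (m : ℝ)..n, F ⌊s⌋ := by
  induction n, h using Int.leInduction with
  | base => simp
  | succ n hmn ih =>
    have hn := intervalIntegrable_comp_floor_unit F n
    have hval : ∫ s in (n : ℝ)..(n + 1), F ⌊s⌋ = F n := by
      rw [intervalIntegral.integral_congr_uIoo (g := fun _ => F n)]
      · simp
      · intro s hs
        rw [Set.uIoo_of_le (by linarith)] at hs
        simp only [(Int.floor_eq_iff).2 ⟨hs.1.le, hs.2⟩]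
    push_cast
    refine ⟨ih.1.trans hn, ?_⟩
    rw [← intervalIntegral.integral_add_adjacent_intervals ih.1 hn, hval, ← ih.2,
      ← Finset.insert_Ico_right_eq_Ico_add_one hmn, Finset.sum_insert (by simp), add_comm]

theorem sum_Ico_eq_integral_comp_floor (F : ℤ → ℝ) {m n : ℤ} (h : m ≤ n) :
    ∑ i ∈ Finset.Ico m n, F i = ∫ s in (m : ℝ)..n, F ⌊s⌋ :=
  (intervalIntegrable_comp_floor_and_sum_eq_integral F h).2

theorem measurable_comp_floor_mul (F : ℤ → ℝ) (c : ℝ) :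
    Measurable fun t : ℝ => F ⌊t * c⌋ :=
  (measurable_of_countable F).comp (Int.measurable_floor.comp (measurable_id.mul_const c))

/-- The unnormalized weight of the point `i / κ` in the `(κ, ρ)`-Vandermonde distribution. -/
noncomputable def vandermondeWeight (ρ κ : ℕ) (i : ℤ) : ℝ :=
  (((κ : ℤ) - i).toNat.choose ρ : ℝ) * (((κ : ℤ) + i).toNat.choose ρ : ℝ)

/-- The rescaled weights, as a step function on the real line. -/
noncomputable def vandermondeStep (ρ κ : ℕ) (t : ℝ) : ℝ :=
  vandermondeWeight ρ κ ⌊t * κ⌋ / (κ : ℝ) ^ (2 * ρ)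

theorem measurable_vandermondeStep (ρ κ : ℕ) : Measurable (vandermondeStep ρ κ) :=
  (measurable_comp_floor_mul (vandermondeWeight ρ κ) κ).div_const _

theorem norm_vandermondeStep_le (ρ : ℕ) {κ : ℕ} (hκ : 0 < κ) {t : ℝ} (h₁ : -1 ≤ t)
    (h₂ : t ≤ 2) : ‖vandermondeStep ρ κ t‖ ≤ 9 ^ ρ := by
  have hκ' : (0 : ℝ) < κ := by exact_mod_cast hκ
  have hlo : -(κ : ℤ) ≤ ⌊t * κ⌋ := by
    rw [Int.le_floor]
    push_cast
    nlinarith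
  have hhi : ⌊t * κ⌋ ≤ 2 * (κ : ℤ) := by
    have : (⌊t * κ⌋ : ℝ) ≤ 2 * κ := (Int.floor_le _).trans (by nlinarith)
    exact_mod_cast this
  have hchoose {n : ℕ} (hn : n ≤ 3 * κ) : (n.choose ρ : ℝ) ≤ (3 * κ) ^ ρ := by
    exact_mod_cast (Nat.choose_le_pow n ρ).trans (Nat.pow_le_pow_left hn ρ)
  rw [vandermondeStep, vandermondeWeight, Real.norm_of_nonneg (by positivity),
    div_le_iff₀ (by positivity)]
  calc _ ≤ ((3 * κ : ℝ) ^ ρ) * (3 * κ) ^ ρ :=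
        mul_le_mul (hchoose (by omega)) (hchoose (by omega)) (by positivity) (by positivity)
    _ = 9 ^ ρ * (κ : ℝ) ^ (2 * ρ) := by
        rw [← mul_pow, pow_mul, ← mul_pow]
        ring

theorem tendsto_vandermondeStep (ρ : ℕ) {t : ℝ} (h₁ : -1 ≤ t) (h₂ : t ≤ 1) :
    Tendsto (fun κ : ℕ => vandermondeStep ρ κ t) atTop
      (𝓝 ((1 - t ^ 2) ^ ρ / (ρ.factorial : ℝ) ^ 2)) := by
  have hfl := tendsto_floor_mul_natCast_div t
  have hsub : Tendsto (fun κ : ℕ => ((((κ : ℤ) - ⌊t * κ⌋).toNat : ℕ) : ℝ) / κ) atTop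
      (𝓝 (1 - t)) := by
    refine (tendsto_const_nhds.sub hfl).congr' ?_
    filter_upwards [eventually_gt_atTop 0] with κ hκ
    have hκ' : (0 : ℝ) < κ := by exact_mod_cast hκ
    have hhi : (⌊t * κ⌋ : ℝ) ≤ κ := (Int.floor_le _).trans (by nlinarith)
    have hhi' : ⌊t * κ⌋ ≤ (κ : ℤ) := by exact_mod_cast hhi
    rw [← Int.cast_natCast (R := ℝ) (Int.toNat _), Int.toNat_of_nonneg (by omega)]
    push_cast
    field_simp
  have hadd : Tendsto (fun κ : ℕ => ((((κ : ℤ) + ⌊t * κ⌋).toNat : ℕ) : ℝ) / κ) atTop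
      (𝓝 (1 + t)) := by
    refine (tendsto_const_nhds.add hfl).congr' ?_
    filter_upwards [eventually_gt_atTop 0] with κ hκ
    have hκ' : (0 : ℝ) < κ := by exact_mod_cast hκ
    have hlo : -(κ : ℤ) ≤ ⌊t * κ⌋ := by
      rw [Int.le_floor]
      push_cast
      nlinarith
    rw [← Int.cast_natCast (R := ℝ) (Int.toNat _), Int.toNat_of_nonneg (by omega)]
    push_cast
    field_simp
  convert (tendsto_choose_div_pow hsub ρ).mul (tendsto_choose_div_pow hadd ρ) using 1
  · ext κ
    rw [vandermondeStep, vandermondeWeight, two_mul, pow_add, mul_div_mul_comm]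
  · rw [div_mul_div_comm, ← mul_pow, ← sq, show (1 - t) * (1 + t) = 1 - t ^ 2 by ring]

theorem sum_vandermondeWeight_div_pow (ρ : ℕ) {κ : ℕ} (hκ : 0 < κ) {M : ℤ}
    (hM : -(κ : ℤ) ≤ M) :
    (∑ i ∈ Finset.Icc (-(κ : ℤ)) M, vandermondeWeight ρ κ i) / (κ : ℝ) ^ (2 * ρ + 1) =
      ∫ t in (-1 : ℝ)..((M + 1) / κ), vandermondeStep ρ κ t := by
  have hκ' : (κ : ℝ) ≠ 0 := by exact_mod_cast hκ.ne'
  have hsum : ∑ i ∈ Finset.Icc (-(κ : ℤ)) M, vandermondeWeight ρ κ i =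
      ∫ s in (-(κ : ℝ))..(M + 1), vandermondeWeight ρ κ ⌊s⌋ := by
    have := sum_Ico_eq_integral_comp_floor (vandermondeWeight ρ κ)
      (show -(κ : ℤ) ≤ M + 1 by omega)
    rw [Finset.Ico_add_one_right_eq_Icc] at this
    simpa using this
  simp only [vandermondeStep]
  rw [intervalIntegral.integral_div,
    intervalIntegral.integral_comp_mul_right (fun s => vandermondeWeight ρ κ ⌊s⌋) hκ',
    div_mul_cancel₀ _ hκ', neg_one_mul, hsum, smul_eq_mul, pow_succ]
  field_simp

theorem tendsto_integral_vandermondeStep (ρ : ℕ) {x : ℝ} (hx₁ : -1 ≤ x) (hx₂ : x ≤ 1) :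
    Tendsto (fun κ : ℕ => ∫ t in (-1 : ℝ)..x, vandermondeStep ρ κ t) atTop
      (𝓝 (∫ t in (-1 : ℝ)..x, (1 - t ^ 2) ^ ρ / (ρ.factorial : ℝ) ^ 2)) := by
  refine intervalIntegral.tendsto_integral_filter_of_dominated_convergence (fun _ => 9 ^ ρ)
    (.of_forall fun κ => (measurable_vandermondeStep ρ κ).aestronglyMeasurable) ?_
    intervalIntegrable_const ?_
  · filter_upwards [eventually_gt_atTop 0] with κ hκ
    refine .of_forall fun t ht => ?_
    rw [Set.uIoc_of_le hx₁] at ht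
    exact norm_vandermondeStep_le ρ hκ ht.1.le (by linarith [ht.2])
  · refine .of_forall fun t ht => ?_
    rw [Set.uIoc_of_le hx₁] at ht
    exact tendsto_vandermondeStep ρ ht.1.le (ht.2.trans hx₂)

theorem intervalIntegrable_vandermondeStep (ρ : ℕ) {κ : ℕ} (hκ : 0 < κ) {a b : ℝ}
    (ha : -1 ≤ a) (hab : a ≤ b) (hb : b ≤ 2) :
    IntervalIntegrable (vandermondeStep ρ κ) volume a b := by
  refine (intervalIntegrable_const (c := (9 : ℝ) ^ ρ)).mono_fun'
    (measurable_vandermondeStep ρ κ).aestronglyMeasurable ?_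
  refine (ae_restrict_iff' measurableSet_uIoc).2 (.of_forall fun t ht => ?_)
  rw [Set.uIoc_of_le hab] at ht
  exact norm_vandermondeStep_le ρ hκ (ha.trans ht.1.le) (ht.2.trans hb)

theorem tendsto_sum_vandermondeWeight_div_pow (ρ : ℕ) {x : ℝ} (hx₁ : -1 ≤ x) (hx₂ : x ≤ 1) :
    Tendsto (fun κ : ℕ => (∑ i ∈ Finset.Icc (-(κ : ℤ)) ⌊x * κ⌋, vandermondeWeight ρ κ i) /
        (κ : ℝ) ^ (2 * ρ + 1)) atTop
      (𝓝 (∫ t in (-1 : ℝ)..x, (1 - t ^ 2) ^ ρ / (ρ.factorial : ℝ) ^ 2)) := by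
  have hrem : Tendsto (fun κ : ℕ => ∫ t in x..((⌊x * κ⌋ + 1) / κ), vandermondeStep ρ κ t) atTop
      (𝓝 0) := by
    refine squeeze_zero_norm' ?_ (tendsto_const_div_atTop_nhds_zero_nat ((9 : ℝ) ^ ρ))
    filter_upwards [eventually_gt_atTop 0] with κ hκ
    have hκ' : (0 : ℝ) < κ := by exact_mod_cast hκ
    have hκ₁ : (1 : ℝ) ≤ κ := by exact_mod_cast hκ
    have hlo : x ≤ (⌊x * κ⌋ + 1) / κ := by
      rw [le_div_iff₀ hκ']
      exact (Int.lt_floor_add_one _).le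
    have hhi : ((⌊x * κ⌋ : ℝ) + 1) / κ - x ≤ 1 / κ := by
      rw [sub_le_iff_le_add, div_add' _ _ _ hκ'.ne']
      exact div_le_div_of_nonneg_right (by linarith [Int.floor_le (x * κ)]) hκ'.le
    have hinv : 1 / (κ : ℝ) ≤ 1 := (div_le_one hκ').2 hκ₁
    refine (intervalIntegral.norm_integral_le_of_norm_le_const (C := 9 ^ ρ) fun t ht => ?_).trans ?_
    · rw [Set.uIoc_of_le hlo] at ht
      exact norm_vandermondeStep_le ρ hκ (hx₁.trans ht.1.le) (by linarith [ht.2])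
    · rw [abs_of_nonneg (by linarith), div_eq_mul_one_div ((9 : ℝ) ^ ρ)]
      exact mul_le_mul_of_nonneg_left hhi (by positivity)
  have hmain := (tendsto_integral_vandermondeStep ρ hx₁ hx₂).add hrem
  rw [add_zero] at hmain
  refine hmain.congr' ?_
  filter_upwards [eventually_gt_atTop 0] with κ hκ
  have hκ' : (0 : ℝ) < κ := by exact_mod_cast hκ
  have hκ₁ : (1 : ℝ) ≤ κ := by exact_mod_cast hκ
  have hM : -(κ : ℤ) ≤ ⌊x * κ⌋ := by
    rw [Int.le_floor]
    push_cast
    nlinarith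
  have hlo : x ≤ (⌊x * κ⌋ + 1) / κ := by
    rw [le_div_iff₀ hκ']
    exact (Int.lt_floor_add_one _).le
  have hhi : ((⌊x * κ⌋ : ℝ) + 1) / κ ≤ 2 := by
    rw [div_le_iff₀ hκ']
    nlinarith [Int.floor_le (x * κ)]
  rw [sum_vandermondeWeight_div_pow ρ hκ hM,
    intervalIntegral.integral_add_adjacent_intervals
      (intervalIntegrable_vandermondeStep ρ hκ le_rfl hx₁ (by linarith))
      (intervalIntegrable_vandermondeStep ρ hκ hx₁ hlo hhi)]

/-- Convergence of the `(κ, ρ)`-Vandermonde distribution: for fixed `ρ` and `x ∈ (−1, 1)`,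
the CDF `(∑_{i=−κ}^{⌊xκ⌋} binom(κ−i, ρ)·binom(κ+i, ρ)) / binom(2κ+1, 2ρ+1)` converges, as
`κ → ∞`, to `C(ρ) · ∫_{−1}^{x} (1−t²)^ρ dt`. -/
theorem stmt_3 (ρ : ℕ) (x : ℝ) (hx₁ : -1 < x) (hx₂ : x < 1) :
    Tendsto (fun κ : ℕ =>
        (∑ i ∈ Finset.Icc (-(κ : ℤ)) ⌊x * κ⌋,
            ((((κ : ℤ) - i).toNat.choose ρ : ℝ) * ((((κ : ℤ) + i).toNat.choose ρ : ℝ))))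
          / ((2 * κ + 1).choose (2 * ρ + 1) : ℝ))
      atTop (nhds (vandermondeC ρ * ∫ t in (-1 : ℝ)..x, (1 - t ^ 2) ^ ρ)) := by
  have hD : Tendsto (fun κ : ℕ => ((2 * κ + 1).choose (2 * ρ + 1) : ℝ) / (κ : ℝ) ^ (2 * ρ + 1))
      atTop (𝓝 (2 ^ (2 * ρ + 1) / (2 * ρ + 1).factorial)) := by
    refine tendsto_choose_div_pow ?_ _
    have h : Tendsto (fun κ : ℕ => 2 + 1 / (κ : ℝ)) atTop (𝓝 2) := by
      simpa using tendsto_const_nhds.add (tendsto_const_div_atTop_nhds_zero_nat (1 : ℝ))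
    refine h.congr' ?_
    filter_upwards [eventually_gt_atTop 0] with κ hκ
    have hκ' : (κ : ℝ) ≠ 0 := by exact_mod_cast hκ.ne'
    push_cast
    field_simp
  convert ((tendsto_sum_vandermondeWeight_div_pow ρ hx₁.le hx₂.le).div hD
    (by positivity)).congr' ?_ using 2
  · rw [intervalIntegral.integral_div, vandermondeC]
    field_simp
  · filter_upwards [eventually_gt_atTop 0] with κ hκ
    have hκ' : (κ : ℝ) ≠ 0 := by exact_mod_cast hκ.ne'
    exact div_div_div_cancel_right₀ (pow_ne_zero _ hκ') _ _
end

section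
/- Let X be a random variable with density φ(t) = C(ρ)(1−t²)^ρ on [−1, 1], where C(ρ) = (2ρ+1)!/((ρ!)² · 2^{2ρ+1}). Then E[|X|] = C(ρ)/(ρ+1), and there exist constants 0 < a ≤ b such that for every integer ρ ≥ 1: a/√ρ ≤ E[|X|] ≤ b/√ρ; that is, E[|X|] = Θ(1/√ρ). Equivalently, a/√ρ ≤ C(ρ) · ∫_{−1}^{1} |t|·(1−t²)^ρ dt ≤ b/√ρ. -/
theorem vandermondeC_zero : vandermondeC 0 = 1 / 2 := by
  norm_num [vandermondeC]

theorem vandermondeC_pos (ρ : ℕ) : 0 < vandermondeC ρ := by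
  unfold vandermondeC
  positivity

theorem vandermondeC_succ (ρ : ℕ) :
    vandermondeC (ρ + 1) = vandermondeC ρ * ((2 * ρ + 3) / (2 * (ρ + 1))) := by
  have h : 2 * (ρ + 1) + 1 = 2 * ρ + 1 + 1 + 1 := by ring
  have hf : (Nat.factorial ρ : ℝ) ≠ 0 := by positivity
  have hρ : (ρ : ℝ) + 1 ≠ 0 := by positivity
  unfold vandermondeC
  rw [h, Nat.factorial_succ (2 * ρ + 1 + 1), Nat.factorial_succ (2 * ρ + 1),
    Nat.factorial_succ ρ]
  push_cast
  field_simp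
  ring

theorem le_sq_vandermondeC (ρ : ℕ) : ((ρ : ℝ) + 1) / 4 ≤ vandermondeC ρ ^ 2 := by
  induction ρ with
  | zero => norm_num [vandermondeC_zero]
  | succ n ih =>
    rw [vandermondeC_succ, mul_pow]
    refine le_trans ?_ (mul_le_mul_of_nonneg_right ih (by positivity))
    push_cast
    rw [div_pow, div_mul_div_comm, div_le_div_iff₀ (by positivity) (by positivity)]
    have hn : (0 : ℝ) ≤ n := n.cast_nonneg
    nlinarith

theorem sq_vandermondeC_le (ρ : ℕ) : vandermondeC ρ ^ 2 ≤ (2 * (ρ : ℝ) + 1) / 4 := by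
  induction ρ with
  | zero => norm_num [vandermondeC_zero]
  | succ n ih =>
    rw [vandermondeC_succ, mul_pow]
    refine le_trans (mul_le_mul_of_nonneg_right ih (by positivity)) ?_
    push_cast
    rw [div_pow, div_mul_div_comm, div_le_div_iff₀ (by positivity) (by positivity)]
    have hn : (0 : ℝ) ≤ n := n.cast_nonneg
    nlinarith

theorem integral_mul_one_sub_sq_pow (ρ : ℕ) :
    ∫ t in (0 : ℝ)..1, t * (1 - t ^ 2) ^ ρ = 1 / (2 * ((ρ : ℝ) + 1)) := by
  have hρ : (ρ : ℝ) + 1 ≠ 0 := by positivity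
  have hderiv (t : ℝ) : HasDerivAt (fun t : ℝ => -(1 - t ^ 2) ^ (ρ + 1) / (2 * ((ρ : ℝ) + 1)))
      (t * (1 - t ^ 2) ^ ρ) t := by
    refine ((((hasDerivAt_pow 2 t).const_sub 1).pow (ρ + 1)).neg.div_const
      (2 * ((ρ : ℝ) + 1))).congr_deriv ?_
    push_cast
    field_simp
  rw [intervalIntegral.integral_eq_sub_of_hasDerivAt (fun t _ => hderiv t)
    (Continuous.intervalIntegrable (by fun_prop) _ _)]
  simp [neg_div]

theorem integral_abs_mul_one_sub_sq_pow (ρ : ℕ) :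
    ∫ t in (-1 : ℝ)..1, |t| * (1 - t ^ 2) ^ ρ = 1 / ((ρ : ℝ) + 1) := by
  have hint (a b : ℝ) : IntervalIntegrable (fun t : ℝ => |t| * (1 - t ^ 2) ^ ρ)
      MeasureTheory.volume a b := Continuous.intervalIntegrable (by fun_prop) _ _
  have hpos : ∫ t in (0 : ℝ)..1, |t| * (1 - t ^ 2) ^ ρ = 1 / (2 * ((ρ : ℝ) + 1)) := by
    rw [← integral_mul_one_sub_sq_pow]
    refine intervalIntegral.integral_congr fun t ht => ?_
    rw [Set.uIcc_of_le zero_le_one] at ht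
    simp only [abs_of_nonneg ht.1]
  have hneg : ∫ t in (-1 : ℝ)..0, |t| * (1 - t ^ 2) ^ ρ
      = ∫ t in (0 : ℝ)..1, |t| * (1 - t ^ 2) ^ ρ := by
    have h := intervalIntegral.integral_comp_neg (a := (0 : ℝ)) (b := 1)
      fun t : ℝ => |t| * (1 - t ^ 2) ^ ρ
    simp only [abs_neg, neg_sq, neg_zero] at h
    exact h.symm
  rw [← intervalIntegral.integral_add_adjacent_intervals (hint (-1) 0) (hint 0 1), hneg, hpos]
  have hρ : (ρ : ℝ) + 1 ≠ 0 := by positivity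
  field_simp
  norm_num

/-- For `X` with density `φ(t) = C(ρ)(1−t²)^ρ` on `[−1, 1]`:
`E[|X|] = C(ρ) · ∫_{−1}^1 |t|(1−t²)^ρ dt = C(ρ)/(ρ+1)`, and `E[|X|] = Θ(1/√ρ)`:
there exist `0 < a ≤ b` with `a/√ρ ≤ E[|X|] ≤ b/√ρ` for all `ρ ≥ 1`. -/
theorem stmt_7 :
    (∀ ρ : ℕ, vandermondeC ρ * ∫ t in (-1 : ℝ)..1, |t| * (1 - t ^ 2) ^ ρ
        = vandermondeC ρ / ((ρ : ℝ) + 1)) ∧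
    ∃ a b : ℝ, 0 < a ∧ a ≤ b ∧ ∀ ρ : ℕ, 1 ≤ ρ →
      a / Real.sqrt ρ ≤ vandermondeC ρ * ∫ t in (-1 : ℝ)..1, |t| * (1 - t ^ 2) ^ ρ ∧
      vandermondeC ρ * ∫ t in (-1 : ℝ)..1, |t| * (1 - t ^ 2) ^ ρ ≤ b / Real.sqrt ρ := by
  have hmean (ρ : ℕ) : vandermondeC ρ * ∫ t in (-1 : ℝ)..1, |t| * (1 - t ^ 2) ^ ρ
      = vandermondeC ρ / ((ρ : ℝ) + 1) := by
    rw [integral_abs_mul_one_sub_sq_pow, mul_one_div]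
  refine ⟨hmean, 1 / 4, 1, by norm_num, by norm_num, fun ρ hρ => ?_⟩
  have hρ' : (1 : ℝ) ≤ ρ := by exact_mod_cast hρ
  have hsqrt : 0 < Real.sqrt ρ := Real.sqrt_pos.2 (by linarith)
  have hC := vandermondeC_pos ρ
  have hsq : (vandermondeC ρ * Real.sqrt ρ) ^ 2 = vandermondeC ρ ^ 2 * ρ := by
    rw [mul_pow, Real.sq_sqrt (by linarith)]
  rw [hmean, div_le_div_iff₀ hsqrt (by positivity), div_le_div_iff₀ (by positivity) hsqrt]
  constructor
  · refine (pow_le_pow_iff_left₀ (by positivity) (by positivity) two_ne_zero).1 ?_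
    rw [hsq]
    nlinarith [le_sq_vandermondeC ρ]
  · refine (pow_le_pow_iff_left₀ (by positivity) (by positivity) two_ne_zero).1 ?_
    rw [hsq]
    nlinarith [sq_vandermondeC_le ρ]
end

section
/- There exists a constant K > 0 with the following property. For every ε > 0 and every odd integer c ≥ K/ε², and for every sequence of instances where the n-th instance consists of points x^{(n)}_1, …, x^{(n)}_n ∈ ℝ (n odd, n ≥ c) whose median x_m^{(n)} has positive social cost SC_n(x_m^{(n)}) > 0: limsup_{n→∞, n odd} E_S[ SC_n( median of (x^{(n)}_i)_{i∈S} ) ] / SC_n(x_m^{(n)}) ≤ 1 + ε, where S is a uniformly random c-element subset of {1, …, n}. That is, a sample of size c = Θ(1/ε²) yields in expectation a 1+ε approximation with respect to the optimal social cost of the full-information median on the line, as n → ∞. -/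
open Filter

/-- The median of a multiset of reals of odd size `2κ+1`: its `(κ+1)`-th smallest element. -/
noncomputable def multisetMedian (s : Multiset ℝ) : ℝ :=
  (s.sort (· ≤ ·)).getD ((Multiset.card s - 1) / 2) 0

section SampleMedian

open MeasureTheory Finset

lemma List.Pairwise.le_countP_getElem {l : List ℝ} (hl : l.Pairwise (· ≤ ·)) {k : ℕ}
    (hk : l.length = 2 * k + 1) (h : k < l.length) :
    k + 1 ≤ l.countP (fun a => l[k] ≤ a) ∧ k + 1 ≤ l.countP (fun a => a ≤ l[k]) := by
  rw [List.pairwise_iff_getElem] at hl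
  have hmono : ∀ i j (hi : i < l.length) (hj : j < l.length), i ≤ j → l[i] ≤ l[j] := by
    intro i j hi hj hij
    rcases hij.eq_or_lt with rfl | hij
    · exact le_rfl
    · exact hl i j hi hj hij
  constructor
  · calc k + 1 = (l.drop k).length := by simp; omega
      _ = (l.drop k).countP (fun a => l[k] ≤ a) := by
        rw [eq_comm, List.countP_eq_length]
        intro a ha
        obtain ⟨i, hi, rfl⟩ := List.mem_iff_getElem.1 ha
        simp only [List.getElem_drop, decide_eq_true_eq]
        exact hmono _ _ _ _ (by omega)
      _ ≤ _ := (List.drop_sublist k l).countP_le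
  · calc k + 1 = (l.take (k + 1)).length := by simp; omega
      _ = (l.take (k + 1)).countP (fun a => a ≤ l[k]) := by
        rw [eq_comm, List.countP_eq_length]
        intro a ha
        obtain ⟨i, hi, rfl⟩ := List.mem_iff_getElem.1 ha
        simp only [List.getElem_take, decide_eq_true_eq]
        simp only [List.length_take] at hi
        exact hmono _ _ _ _ (by omega)
      _ ≤ _ := (List.take_sublist (k + 1) l).countP_le

lemma multisetMedian_countP {s : Multiset ℝ} {k : ℕ} (hs : Multiset.card s = 2 * k + 1) :
    k + 1 ≤ s.countP (multisetMedian s ≤ ·) ∧ k + 1 ≤ s.countP (· ≤ multisetMedian s) := by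
  have hlen : (s.sort (· ≤ ·)).length = 2 * k + 1 := by rw [Multiset.length_sort, hs]
  have hmed : multisetMedian s = (s.sort (· ≤ ·))[k]'(by omega) := by
    rw [multisetMedian, show (Multiset.card s - 1) / 2 = k by omega]
    exact List.getD_eq_getElem _ _ _
  have h := (Multiset.pairwise_sort s (· ≤ ·)).le_countP_getElem hlen (by omega)
  rw [← hmed, ← Multiset.coe_countP, ← Multiset.coe_countP, Multiset.sort_eq] at h
  exact h

lemma multisetMedian_card_filter {ι : Type*} (x : ι → ℝ) {S : Finset ι} {k : ℕ}
    (hS : #S = 2 * k + 1) :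
    k + 1 ≤ #{i ∈ S | multisetMedian (S.val.map x) ≤ x i} ∧
      k + 1 ≤ #{i ∈ S | x i ≤ multisetMedian (S.val.map x)} := by
  have h := multisetMedian_countP (s := S.val.map x) (k := k) (by simpa using hS)
  rwa [Multiset.countP_map, Multiset.countP_map] at h

lemma integrable_indicator_Iio_one (a m : ℝ) :
    Integrable ((Set.Iio a).indicator (1 : ℝ → ℝ)) (volume.restrict (Set.Ioi m)) := by
  rw [integrable_indicator_iff measurableSet_Iio]
  refine integrableOn_const ?_
  rw [Measure.restrict_apply measurableSet_Iio, Set.inter_comm, Set.Ioi_inter_Iio]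
  exact measure_Ioo_lt_top.ne

lemma integral_indicator_Iio_one (a m : ℝ) :
    ∫ θ in Set.Ioi m, (Set.Iio a).indicator (1 : ℝ → ℝ) θ = max (a - m) 0 := by
  rw [integral_indicator_one measurableSet_Iio, Measure.real,
    Measure.restrict_apply measurableSet_Iio, Set.inter_comm, Set.Ioi_inter_Iio,
    Real.volume_Ioo, ENNReal.toReal_ofReal']

lemma abs_sub_max_sub_abs_sub (x y m : ℝ) :
    |x - max y m| - |x - m| = max (y - m) 0 - 2 * max (min y x - m) 0 := by
  grind

section Sampling

variable {ι : Type*} [Fintype ι] [DecidableEq ι]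

/-- The factorial moments of the hypergeometric distribution. -/
lemma sum_choose_card_inter_mul (T : Finset ι) (c j : ℕ) :
    (∑ S ∈ powersetCard c (univ : Finset ι), (#(S ∩ T)).choose j) * (Fintype.card ι).choose j =
      (#T).choose j * ((Fintype.card ι).choose c * c.choose j) := by
  rcases lt_or_ge c j with hj | hj
  · rw [Nat.choose_eq_zero_of_lt hj, sum_eq_zero]
    · simp
    · intro S hS
      refine Nat.choose_eq_zero_of_lt (lt_of_le_of_lt (card_le_card inter_subset_left) ?_)
      rwa [(mem_powersetCard.1 hS).2]
  · have hcount : ∑ S ∈ powersetCard c (univ : Finset ι), (#(S ∩ T)).choose j =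
        (#T).choose j * (Fintype.card ι - j).choose (c - j) := by
      calc ∑ S ∈ powersetCard c (univ : Finset ι), (#(S ∩ T)).choose j
          = ∑ S ∈ powersetCard c (univ : Finset ι), #{A ∈ powersetCard j T | A ⊆ S} := by
            refine sum_congr rfl fun S _ => ?_
            rw [← card_powersetCard]
            congr 1
            ext A
            simp only [mem_powersetCard, mem_filter, subset_inter_iff]
            tauto
        _ = ∑ A ∈ powersetCard j T, #{S ∈ powersetCard c (univ : Finset ι) | A ⊆ S} := by
            simp only [card_filter]
            exact sum_comm
        _ = ∑ A ∈ powersetCard j T, (Fintype.card ι - j).choose (c - j) := by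
            refine sum_congr rfl fun A hA => ?_
            have hA' := (mem_powersetCard.1 hA).2
            rw [card_filter_powersetCard_subset A univ c (subset_univ A) (hA'.trans_le hj),
              hA', card_univ]
        _ = _ := by rw [sum_const, card_powersetCard, smul_eq_mul]
    rw [hcount, Nat.choose_mul hj]
    ring

lemma sum_card_inter_mul (T : Finset ι) (c : ℕ) :
    (∑ S ∈ powersetCard c (univ : Finset ι), (#(S ∩ T) : ℝ)) * Fintype.card ι =
      #T * ((Fintype.card ι).choose c * c) := by
  have h := sum_choose_card_inter_mul T c 1
  simp only [Nat.choose_one_right] at h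
  exact_mod_cast h

/-- The variance bound for the hypergeometric distribution. -/
lemma sum_sq_card_inter_sub_le (T : Finset ι) {c : ℕ} (hc : c ≤ Fintype.card ι) :
    ∑ S ∈ powersetCard c (univ : Finset ι),
        ((Fintype.card ι : ℝ) * #(S ∩ T) - c * #T) ^ 2 ≤
      Fintype.card ι * c * #T * (Fintype.card ι).choose c := by
  have h1 := sum_card_inter_mul T c
  have h2 : (∑ S ∈ powersetCard c (univ : Finset ι), (#(S ∩ T) : ℝ) * (#(S ∩ T) - 1)) *
      (Fintype.card ι * (Fintype.card ι - 1)) =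
      #T * (#T - 1) * ((Fintype.card ι).choose c * (c * (c - 1))) := by
    have h := congrArg (Nat.cast (R := ℝ)) (sum_choose_card_inter_mul T c 2)
    push_cast [Nat.cast_choose_two] at h
    rw [← sum_div] at h
    linarith
  have hB : (∑ S ∈ powersetCard c (univ : Finset ι), (1 : ℝ)) = (Fintype.card ι).choose c := by
    simp
  have hsplit : ∑ S ∈ powersetCard c (univ : Finset ι),
        ((Fintype.card ι : ℝ) * #(S ∩ T) - c * #T) ^ 2 =
      (Fintype.card ι : ℝ) ^ 2 *
          (∑ S ∈ powersetCard c (univ : Finset ι), (#(S ∩ T) : ℝ) * (#(S ∩ T) - 1)) +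
        ((Fintype.card ι : ℝ) ^ 2 - 2 * Fintype.card ι * c * #T) *
          (∑ S ∈ powersetCard c (univ : Finset ι), (#(S ∩ T) : ℝ)) +
        (c * #T : ℝ) ^ 2 * (∑ S ∈ powersetCard c (univ : Finset ι), (1 : ℝ)) := by
    simp only [mul_sum, ← sum_add_distrib]
    exact sum_congr rfl fun S _ => by ring
  have key : (Fintype.card ι : ℝ) ^ 2 *
      (∑ S ∈ powersetCard c (univ : Finset ι), (#(S ∩ T) : ℝ) * (#(S ∩ T) - 1)) ≤
      (c * #T : ℝ) ^ 2 * (Fintype.card ι).choose c := by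
    rcases le_or_gt (Fintype.card ι) 1 with hn | hn
    · refine le_trans (mul_nonpos_of_nonneg_of_nonpos (by positivity)
        (sum_nonpos fun S _ => ?_)) (by positivity)
      have hS : (#(S ∩ T) : ℝ) ≤ 1 := by exact_mod_cast (card_le_univ _).trans hn
      exact mul_nonpos_of_nonneg_of_nonpos (by positivity) (by linarith)
    · have hn' : (0 : ℝ) < Fintype.card ι - 1 := by
        have : (1 : ℝ) < Fintype.card ι := by exact_mod_cast hn
        linarith
      have hc' : (c : ℝ) ≤ Fintype.card ι := by exact_mod_cast hc
      refine le_of_mul_le_mul_right ?_ hn'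
      calc _ = (Fintype.card ι : ℝ) * ((∑ S ∈ powersetCard c (univ : Finset ι),
              (#(S ∩ T) : ℝ) * (#(S ∩ T) - 1)) *
              (Fintype.card ι * (Fintype.card ι - 1))) := by ring
        _ = ((Fintype.card ι).choose c * c * #T) *
              ((#T - 1) * (Fintype.card ι * (c - 1))) := by rw [h2]; ring
        _ ≤ ((Fintype.card ι).choose c * c * #T) * (#T * ((Fintype.card ι - 1) * c)) := by
            rcases Nat.eq_zero_or_pos (#T) with hT | hT
            · simp [hT]
            rcases Nat.eq_zero_or_pos c with h0 | h0
            · simp [h0]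
            have h1c : (1 : ℝ) ≤ c := by exact_mod_cast h0
            refine mul_le_mul_of_nonneg_left ?_ (by positivity)
            refine mul_le_mul (by linarith) (by nlinarith) ?_ (by positivity)
            exact mul_nonneg (by positivity) (by linarith)
        _ = _ := by ring
  rw [hsplit, hB]
  have h3 : ((Fintype.card ι : ℝ) ^ 2 - 2 * Fintype.card ι * c * #T) *
      (∑ S ∈ powersetCard c (univ : Finset ι), (#(S ∩ T) : ℝ)) =
      (Fintype.card ι - 2 * c * #T) * (#T * ((Fintype.card ι).choose c * c)) := by
    rw [← h1]; ring
  rw [h3]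
  linarith

/-- A minority `T` of the population rarely forms a majority of a random sample. -/
lemma card_majority_mul_le (T : Finset ι) {k : ℕ} {ε : ℝ} (hε : 0 < ε)
    (hc : 2 * k + 1 ≤ Fintype.card ι) (hcε : 8 ≤ (2 * k + 1) * ε ^ 2)
    (hT : 2 * #T ≤ Fintype.card ι) :
    (#{S ∈ powersetCard (2 * k + 1) (univ : Finset ι) | k + 1 ≤ #(S ∩ T)} : ℝ) *
        (Fintype.card ι - 2 * #T) ≤
      ε * (Fintype.card ι).choose (2 * k + 1) * #T := by
  set F := {S ∈ powersetCard (2 * k + 1) (univ : Finset ι) | k + 1 ≤ #(S ∩ T)} with hF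
  have hFsub : F ⊆ powersetCard (2 * k + 1) (univ : Finset ι) := filter_subset _ _
  have h1 := sum_card_inter_mul T (2 * k + 1)
  have h2 := sum_sq_card_inter_sub_le T hc
  have hFk : ∀ S ∈ F, (k + 1 : ℝ) ≤ #(S ∩ T) := fun S hS => by
    exact_mod_cast (mem_filter.1 hS).2
  have hnt : (0 : ℝ) ≤ Fintype.card ι - 2 * #T := by
    rw [sub_nonneg]
    exact_mod_cast hT
  push_cast at h1 h2
  set n : ℝ := (Fintype.card ι : ℝ) with hn
  set B : ℝ := ((Fintype.card ι).choose (2 * k + 1) : ℝ)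
  set t : ℝ := (#T : ℝ)
  have hn0 : 0 < n := by
    rw [hn]; exact_mod_cast (by omega : 0 < Fintype.card ι)
  have ht0 : 0 ≤ t := by positivity
  have hB0 : 0 ≤ B := by positivity
  have hc0 : (0 : ℝ) < 2 * k + 1 := by positivity
  have markov : n * #F ≤ 2 * t * B := by
    have h3 : (#F : ℝ) * (k + 1) ≤
        ∑ S ∈ powersetCard (2 * k + 1) (univ : Finset ι), (#(S ∩ T) : ℝ) := by
      rw [← nsmul_eq_mul]
      exact (card_nsmul_le_sum F _ _ hFk).trans
        (sum_le_sum_of_subset_of_nonneg hFsub fun _ _ _ => by positivity)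
    refine le_of_mul_le_mul_right ?_ hc0
    have h4 := mul_le_mul_of_nonneg_right h3 hn0.le
    rw [h1] at h4
    nlinarith [mul_nonneg (Nat.cast_nonneg (α := ℝ) (#F)) hn0.le]
  have chebyshev : #F * (2 * k + 1) * (n - 2 * t) ^ 2 ≤ 4 * n * t * B := by
    have h3 : (#F : ℝ) * ((2 * k + 1) * (n - 2 * t) / 2) ^ 2 ≤
        ∑ S ∈ powersetCard (2 * k + 1) (univ : Finset ι),
          (n * #(S ∩ T) - (2 * k + 1) * t) ^ 2 := by
      rw [← nsmul_eq_mul]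
      refine (card_nsmul_le_sum F _ _ fun S hS => ?_).trans
        (sum_le_sum_of_subset_of_nonneg hFsub fun _ _ _ => sq_nonneg _)
      refine pow_le_pow_left₀ (by positivity) ?_ 2
      nlinarith [mul_le_mul_of_nonneg_left (hFk S hS) hn0.le]
    refine le_of_mul_le_mul_right ?_ hc0
    linarith
  have hmul : n * #F * (#F * (2 * k + 1) * (n - 2 * t) ^ 2) ≤ 2 * t * B * (4 * n * t * B) :=
    mul_le_mul markov chebyshev (by positivity) (by positivity)
  refine (pow_le_pow_iff_left₀ (by positivity) (by positivity) two_ne_zero).1 ?_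
  refine le_of_mul_le_mul_right ?_ (mul_pos hn0 hc0)
  calc _ = n * #F * (#F * (2 * k + 1) * (n - 2 * t) ^ 2) := by ring
    _ ≤ 2 * t * B * (4 * n * t * B) := hmul
    _ = 8 * (n * (t * B) ^ 2) := by ring
    _ ≤ (2 * k + 1) * ε ^ 2 * (n * (t * B) ^ 2) := by gcongr
    _ = _ := by ring

/-- If each `y S` has a majority of the sample `S` above it and `m` has a minority of the population
strictly above it, then moving from `m` to `max (y S) m` costs little on average. -/
lemma sum_cost_max_sub_le (x : ι → ℝ) (y : Finset ι → ℝ) {m : ℝ} {k : ℕ} {ε : ℝ}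
    (hε : 0 < ε) (hc : 2 * k + 1 ≤ Fintype.card ι) (hcε : 8 ≤ (2 * k + 1) * ε ^ 2)
    (hm : 2 * #{i | m < x i} ≤ Fintype.card ι)
    (hy : ∀ S ∈ powersetCard (2 * k + 1) (univ : Finset ι), k + 1 ≤ #{i ∈ S | y S ≤ x i}) :
    ∑ S ∈ powersetCard (2 * k + 1) (univ : Finset ι), ∑ i,
        (|x i - max (y S) m| - |x i - m|) ≤
      ε * (Fintype.card ι).choose (2 * k + 1) * ∑ i, max (x i - m) 0 := by
  have hint (a : ℝ) := integrable_indicator_Iio_one a m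
  have hL : Integrable (fun θ => ∑ S ∈ powersetCard (2 * k + 1) (univ : Finset ι), ∑ i,
      ((Set.Iio (y S)).indicator (1 : ℝ → ℝ) θ -
        2 * (Set.Iio (min (y S) (x i))).indicator (1 : ℝ → ℝ) θ))
      (volume.restrict (Set.Ioi m)) :=
    integrable_finsetSum _ fun S _ => integrable_finsetSum _ fun i _ =>
      (hint _).sub ((hint _).const_mul 2)
  have hR : Integrable (fun θ => ε * (Fintype.card ι).choose (2 * k + 1) *
      ∑ i, (Set.Iio (x i)).indicator (1 : ℝ → ℝ) θ) (volume.restrict (Set.Ioi m)) :=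
    (integrable_finsetSum _ fun i _ => hint _).const_mul _
  have hpt : ∀ θ ∈ Set.Ioi m, (∑ S ∈ powersetCard (2 * k + 1) (univ : Finset ι), ∑ i,
      ((Set.Iio (y S)).indicator (1 : ℝ → ℝ) θ -
        2 * (Set.Iio (min (y S) (x i))).indicator (1 : ℝ → ℝ) θ)) ≤
      ε * (Fintype.card ι).choose (2 * k + 1) *
        ∑ i, (Set.Iio (x i)).indicator (1 : ℝ → ℝ) θ := by
    intro θ hθ
    set T : Finset ι := {i | θ < x i} with hT
    have hTm : 2 * #T ≤ Fintype.card ι := by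
      refine le_trans (Nat.mul_le_mul_left 2 (card_le_card fun i hi => ?_)) hm
      simp only [hT, mem_filter, mem_univ, true_and] at hi ⊢
      exact lt_trans hθ hi
    have hnT : (0 : ℝ) ≤ Fintype.card ι - 2 * #T := by
      rw [sub_nonneg]
      exact_mod_cast hTm
    have hTsum : ∑ i, (Set.Iio (x i)).indicator (1 : ℝ → ℝ) θ = #T := by
      simp [Set.indicator_apply, hT]
    have hterm : ∀ S, ∑ i, ((Set.Iio (y S)).indicator (1 : ℝ → ℝ) θ -
        2 * (Set.Iio (min (y S) (x i))).indicator (1 : ℝ → ℝ) θ) =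
        if θ < y S then (Fintype.card ι - 2 * #T : ℝ) else 0 := by
      intro S
      split_ifs with h
      · simp [Set.indicator_apply, h, hT, ← sum_filter, mul_comm]
      · simp [h]
    rw [hTsum, sum_congr rfl fun S _ => hterm S, ← sum_filter, sum_const, nsmul_eq_mul]
    refine le_trans (mul_le_mul_of_nonneg_right ?_ hnT) (card_majority_mul_le T hε hc hcε hTm)
    refine Nat.cast_le.2 (card_le_card fun S hS => ?_)
    rw [mem_filter] at hS ⊢
    refine ⟨hS.1, (hy S hS.1).trans (card_le_card fun i hi => ?_)⟩
    simp only [mem_filter, mem_inter, hT, mem_univ, true_and] at hi ⊢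
    exact ⟨hi.1, hS.2.trans_le hi.2⟩
  have h := setIntegral_mono_on hL hR measurableSet_Ioi hpt
  rw [integral_const_mul, integral_finsetSum _ fun i _ => hint _, integral_finsetSum] at h
  · simp only [integral_indicator_Iio_one] at h
    refine le_trans (le_of_eq (sum_congr rfl fun S _ => ?_)) h
    rw [integral_finsetSum]
    · refine sum_congr rfl fun i _ => ?_
      rw [integral_sub (hint _) ((hint _).const_mul 2), integral_const_mul,
        integral_indicator_Iio_one, integral_indicator_Iio_one, abs_sub_max_sub_abs_sub]
    · exact fun i _ => (hint _).sub ((hint _).const_mul 2)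
  · exact fun S _ => integrable_finsetSum _ fun i _ => (hint _).sub ((hint _).const_mul 2)

/-- The sample medians `y S` are on average almost as good as the population median `m`. -/
lemma sum_cost_le (x : ι → ℝ) (y : Finset ι → ℝ) {m : ℝ} {k : ℕ} {ε : ℝ}
    (hε : 0 < ε) (hc : 2 * k + 1 ≤ Fintype.card ι) (hcε : 8 ≤ (2 * k + 1) * ε ^ 2)
    (hm : 2 * #{i | m < x i} ≤ Fintype.card ι) (hm' : 2 * #{i | x i < m} ≤ Fintype.card ι)
    (hy : ∀ S ∈ powersetCard (2 * k + 1) (univ : Finset ι), k + 1 ≤ #{i ∈ S | y S ≤ x i})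
    (hy' : ∀ S ∈ powersetCard (2 * k + 1) (univ : Finset ι), k + 1 ≤ #{i ∈ S | x i ≤ y S}) :
    ∑ S ∈ powersetCard (2 * k + 1) (univ : Finset ι), ∑ i, |x i - y S| ≤
      (1 + ε) * ((Fintype.card ι).choose (2 * k + 1) * ∑ i, |x i - m|) := by
  have hpos := sum_cost_max_sub_le x y hε hc hcε hm hy
  have hneg := sum_cost_max_sub_le (fun i => -x i) (fun S => -y S) (m := -m) hε hc hcε
    (by simpa using hm') (by simpa using hy')
  have hsplit : ∀ a b : ℝ, |a - b| = |a - m| + (|a - max b m| - |a - m|) +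
      (|-a - max (-b) (-m)| - |-a - -m|) := by
    intro a b
    rw [max_neg_neg, show -a - -min b m = -(a - min b m) by ring,
      show -a - -m = -(a - m) by ring, abs_neg, abs_neg]
    rcases le_total b m with h | h <;> simp [h]
  have habs : ∑ i, |x i - m| = ∑ i, max (x i - m) 0 + ∑ i, max (-x i - -m) 0 := by
    rw [← sum_add_distrib]
    refine sum_congr rfl fun i _ => ?_
    grind
  have htotal : ∑ S ∈ powersetCard (2 * k + 1) (univ : Finset ι), ∑ i, |x i - m| =
      (Fintype.card ι).choose (2 * k + 1) * ∑ i, |x i - m| := by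
    rw [sum_const, card_powersetCard, card_univ, nsmul_eq_mul]
  rw [sum_congr rfl fun S _ => sum_congr rfl fun i _ => hsplit (x i) (y S)]
  simp only [sum_add_distrib]
  rw [htotal]
  calc _ ≤ _ := add_le_add (add_le_add le_rfl hpos) hneg
    _ = _ := by rw [habs]; ring

end Sampling

end SampleMedian

/-- Sampling median on the line: there is `K > 0` such that for every `ε > 0` and every odd
sample size `c ≥ K/ε²`, and for every sequence of instances `x κ : Fin (2κ+1) → ℝ` whose
(full-information) median has positive social cost, the expected social cost of the median of a
uniformly random `c`-element subset of the agents is at most `(1+ε)` times the optimal social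
cost, in the limit `n = 2κ+1 → ∞` (limsup over `κ`). -/
theorem stmt_9 :
    ∃ K : ℝ, 0 < K ∧ ∀ ε : ℝ, 0 < ε → ∀ c : ℕ, Odd c → K / ε ^ 2 ≤ (c : ℝ) →
      ∀ x : (κ : ℕ) → Fin (2 * κ + 1) → ℝ,
        (∀ κ : ℕ, c ≤ 2 * κ + 1 →
          0 < socialCost (x κ) (multisetMedian (Multiset.map (x κ) Finset.univ.val))) →
        limsup (fun κ : ℕ =>
            ((∑ S ∈ Finset.powersetCard c (Finset.univ : Finset (Fin (2 * κ + 1))),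
                socialCost (x κ) (multisetMedian (Multiset.map (x κ) S.val)))
              / ((2 * κ + 1).choose c : ℝ))
            / socialCost (x κ) (multisetMedian (Multiset.map (x κ) Finset.univ.val)))
          atTop ≤ 1 + ε := by
  refine ⟨8, by norm_num, fun ε hε c hc hcε x hx => ?_⟩
  obtain ⟨k, rfl⟩ := hc
  rw [div_le_iff₀ (by positivity)] at hcε
  push_cast at hcε
  refine limsup_le_of_le ?_ ?_
  · refine IsBoundedUnder.isCoboundedUnder_le (isBoundedUnder_of ⟨0, fun κ => ?_⟩)
    unfold socialCost
    positivity
  · filter_upwards [eventually_ge_atTop k] with κ hκ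
    have hcard : (Finset.univ : Finset (Fin (2 * κ + 1))).card = 2 * κ + 1 := by simp
    have hmed := multisetMedian_card_filter (x κ) hcard
    have hB : 0 < (2 * κ + 1).choose (2 * k + 1) := Nat.choose_pos (by omega)
    rw [div_le_iff₀ (hx κ (by omega)), div_le_iff₀ (by exact_mod_cast hB), mul_assoc,
      mul_comm (socialCost _ _)]
    set m := multisetMedian (Multiset.map (x κ) Finset.univ.val)
    have h1 := Finset.card_filter_add_card_filter_not (s := Finset.univ) (fun i => m ≤ x κ i)
    have h2 := Finset.card_filter_add_card_filter_not (s := Finset.univ) (fun i => x κ i ≤ m)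
    simp only [not_le, hcard] at h1 h2
    have hS : ∀ S ∈ Finset.powersetCard (2 * k + 1) (Finset.univ : Finset (Fin (2 * κ + 1))),
        S.card = 2 * k + 1 := fun S hS => (Finset.mem_powersetCard.1 hS).2
    have h := sum_cost_le (x κ) (fun S => multisetMedian (S.val.map (x κ))) (m := m) hε
      (k := k) (by simp; omega) hcε (by simp only [Fintype.card_fin]; omega)
      (by simp only [Fintype.card_fin]; omega)
      (fun S h => (multisetMedian_card_filter (x κ) (hS S h)).1)
      (fun S h => (multisetMedian_card_filter (x κ) (hS S h)).2)
    simpa only [Fintype.card_fin, socialCost] using h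
end

section
/- There exists a constant K > 0 with the following property. For every ε ∈ (0, 1), every δ ∈ (0, 1), and every odd integer c ≥ K/(εδ)², and for every sequence of instances where the n-th instance consists of points x^{(n)}_1, …, x^{(n)}_n ∈ ℝ (n odd, n ≥ c) with median x_m^{(n)}: limsup_{n→∞, n odd} Pr_S[ SC_n( median of (x^{(n)}_i)_{i∈S} ) > (1+ε)·SC_n(x_m^{(n)}) ] ≤ δ, where S is a uniformly random c-element subset of {1, …, n}. That is, a sample of size c = Θ(1/(εδ)²) yields with probability at least 1−δ a 1+ε approximation with respect to the optimal social cost of the full-information median on the line, as n → ∞. -/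
open Filter

open Finset in
/-- Double counting: sampling `c` elements without replacement, the second moment of the sample
sum of a centred function bounded by `1` is at most `c`. -/
theorem sum_powersetCard_sq_sum_le {α : Type*} [Fintype α] [DecidableEq α] (c : ℕ) (f : α → ℝ)
    (hf : ∑ i, f i = 0) (hf1 : ∀ i, f i ^ 2 ≤ 1) :
    ∑ S ∈ powersetCard c (univ : Finset α), (∑ i ∈ S, f i) ^ 2
      ≤ c * ((Fintype.card α).choose c : ℝ) := by
  set P := powersetCard c (univ : Finset α) with hP
  let N : α → α → ℝ := fun i j => ∑ S ∈ P, if i ∈ S ∧ j ∈ S then 1 else 0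
  have h_swap : ∑ S ∈ P, (∑ i ∈ S, f i) ^ 2 = ∑ i, f i * ∑ j, N i j * f j := by
    have h_term : ∀ S : Finset α, (∑ i ∈ S, f i) ^ 2 =
        ∑ i, ∑ j, f i * ((if i ∈ S ∧ j ∈ S then 1 else 0) * f j) := by
      intro S
      have h_ite : ∑ i ∈ S, f i = ∑ i, if i ∈ S then f i else 0 := by simp
      rw [sq, h_ite, sum_mul_sum]
      refine sum_congr rfl fun i _ => sum_congr rfl fun j _ => ?_
      by_cases hi : i ∈ S <;> by_cases hj : j ∈ S <;> simp [hi, hj]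
    simp_rw [h_term, N, mul_sum, sum_mul, mul_sum]
    rw [sum_comm]
    exact sum_congr rfl fun i _ => sum_comm
  obtain ⟨M, hM0, hM⟩ : ∃ M : ℝ, 0 ≤ M ∧ ∀ i j, i ≠ j → N i j = M := by
    have h_card : ∀ i j, N i j = #{S ∈ P | {i, j} ⊆ S} := by
      intro i j
      simp only [N, sum_boole, insert_subset_iff, singleton_subset_iff]
    by_cases hc : 2 ≤ c
    · refine ⟨((#(univ : Finset α) - 2).choose (c - 2) : ℕ), by positivity, fun i j hij => ?_⟩
      rw [h_card, hP, card_filter_powersetCard_subset _ _ _ (subset_univ _) (by rwa [card_pair hij]),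
        card_pair hij]
    · refine ⟨0, le_rfl, fun i j hij => ?_⟩
      rw [h_card, Nat.cast_eq_zero, card_eq_zero, filter_eq_empty_iff]
      intro S hS hij'
      have := card_le_card hij'
      rw [card_pair hij, (mem_powersetCard.1 hS).2] at this
      exact hc this
  have h_inner : ∀ i, ∑ j, N i j * f j = (N i i - M) * f i := by
    intro i
    have h_eq : ∀ j, N i j * f j = M * f j + if j = i then (N i i - M) * f i else 0 := by
      intro j
      split_ifs with h
      · subst h; ring
      · rw [hM i j (Ne.symm h)]; ring
    simp_rw [h_eq, sum_add_distrib, ← mul_sum, hf]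
    simp
  have h_diag : ∑ i, N i i = c * ((Fintype.card α).choose c : ℝ) := by
    simp only [N, and_self]
    rw [sum_comm]
    have h_card : ∀ S ∈ P, (∑ i : α, if i ∈ S then (1 : ℝ) else 0) = c := by
      intro S hS
      simp [(mem_powersetCard.1 hS).2]
    rw [sum_congr rfl h_card]
    simp [hP, mul_comm]
  rw [h_swap, ← h_diag]
  refine sum_le_sum fun i _ => ?_
  have hN : 0 ≤ N i i := sum_nonneg fun S _ => by split_ifs <;> simp
  rw [h_inner]
  nlinarith [mul_nonneg hM0 (sq_nonneg (f i)), mul_le_mul_of_nonneg_left (hf1 i) hN]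

open Finset in
/-- Chebyshev's inequality for the size of the intersection of a random `c`-subset with a set of
density at most `1/2 - η`. -/
theorem card_powersetCard_filter_majority_le {α : Type*} [Fintype α] [DecidableEq α] [Nonempty α]
    (A : Finset α) {c : ℕ} (hc : 0 < c) {η : ℝ} (hη : 0 < η)
    (hA : (#A : ℝ) ≤ (1 / 2 - η) * Fintype.card α) :
    (#{S ∈ powersetCard c (univ : Finset α) | c < 2 * #(S ∩ A)} : ℝ)
      ≤ (Fintype.card α).choose c / (c * η ^ 2) := by
  set n : ℝ := (Fintype.card α : ℝ) with hn
  have hn0 : 0 < n := by simp [hn, Fintype.card_pos]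
  have hA_le : (#A : ℝ) ≤ n := by rw [hn]; exact_mod_cast card_le_univ A
  set p : ℝ := #A / n with hp
  have hp0 : 0 ≤ p := by positivity
  have hp1 : p ≤ 1 := by rw [hp, div_le_one hn0]; exact hA_le
  have hpη : p ≤ 1 / 2 - η := by rw [hp, div_le_iff₀ hn0]; exact hA
  have hc' : (0 : ℝ) < c := by exact_mod_cast hc
  let f : α → ℝ := fun i => (if i ∈ A then 1 else 0) - p
  have h_moment := sum_powersetCard_sq_sum_le c f
    (by simp [f, sum_sub_distrib, hp, ← hn]; field_simp; ring)
    (fun i => by simp only [f]; split_ifs <;> nlinarith)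
  set B := {S ∈ powersetCard c (univ : Finset α) | c < 2 * #(S ∩ A)}
  have h_markov : (#B : ℝ) * (c * η) ^ 2 ≤ c * ((Fintype.card α).choose c : ℝ) := by
    refine le_trans ?_ h_moment
    rw [← nsmul_eq_mul]
    refine (card_nsmul_le_sum B (fun S => (∑ i ∈ S, f i) ^ 2) _ fun S hS => ?_).trans
      (sum_le_sum_of_subset_of_nonneg (filter_subset _ _) fun _ _ _ => sq_nonneg _)
    obtain ⟨hS, hSA⟩ := mem_filter.1 hS
    have h_sum : ∑ i ∈ S, f i = #(S ∩ A) - c * p := by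
      simp [f, sum_sub_distrib, (mem_powersetCard.1 hS).2]
    have hSA' : (c : ℝ) < 2 * #(S ∩ A) := by exact_mod_cast hSA
    rw [h_sum]
    refine pow_le_pow_left₀ (by positivity) ?_ 2
    nlinarith
  rw [le_div_iff₀ (by positivity)]
  refine le_of_mul_le_mul_left ?_ hc'
  linarith

open Finset in
/-- Few `c`-subsets have a majority lying in a tail `[y, ∞)` of density less than `1/2 - η`. -/
theorem card_powersetCard_filter_tail_le {α : Type*} [Fintype α] [DecidableEq α] [Nonempty α]
    (x : α → ℝ) {c : ℕ} (hc : 0 < c) {η : ℝ} (hη : 0 < η) (hη' : η ≤ 1 / 2)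
    (B : Finset (Finset α))
    (hB : ∀ S ∈ B, #S = c ∧ ∃ y, c < 2 * #{i ∈ S | y ≤ x i} ∧
      (#{i | y ≤ x i} : ℝ) < (1 / 2 - η) * Fintype.card α) :
    (#B : ℝ) ≤ (Fintype.card α).choose c / (c * η ^ 2) := by
  classical
  let A : Finset α := {i | (#{j | x i ≤ x j} : ℝ) < (1 / 2 - η) * Fintype.card α}
  have hA : (#A : ℝ) ≤ (1 / 2 - η) * Fintype.card α := by
    rcases A.eq_empty_or_nonempty with h | h
    · rw [h, card_empty, Nat.cast_zero]
      exact mul_nonneg (by linarith) (by positivity)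
    · obtain ⟨i, hi, hmin⟩ := exists_min_image A x h
      refine le_trans ?_ (mem_filter.1 hi).2.le
      exact_mod_cast card_le_card fun j hj => mem_filter.2 ⟨mem_univ j, hmin j hj⟩
  refine le_trans ?_ (card_powersetCard_filter_majority_le A hc hη hA)
  norm_cast
  refine card_le_card fun S hS => ?_
  obtain ⟨hSc, y, hy, hyη⟩ := hB S hS
  refine mem_filter.2 ⟨mem_powersetCard.2 ⟨subset_univ S, hSc⟩, hy.trans_le ?_⟩
  refine Nat.mul_le_mul_left 2 (card_le_card fun i hi => ?_)
  obtain ⟨hiS, hyi⟩ := mem_filter.1 hi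
  refine mem_inter.2 ⟨hiS, mem_filter.2 ⟨mem_univ i, lt_of_le_of_lt ?_ hyη⟩⟩
  exact_mod_cast card_le_card fun j hj =>
    mem_filter.2 ⟨mem_univ j, hyi.trans (mem_filter.1 hj).2⟩

theorem multisetMedian_eq_getElem (s : Multiset ℝ) {r : ℕ} (hr : Multiset.card s = 2 * r + 1) :
    multisetMedian s = (s.sort (· ≤ ·))[r]'(by rw [Multiset.length_sort]; lia) := by
  rw [multisetMedian, show (Multiset.card s - 1) / 2 = r by lia]
  exact List.getD_eq_getElem _ _ _

/-- More than half of an odd multiset lies weakly above its median. -/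
theorem card_lt_two_mul_card_filter_median_le (s : Multiset ℝ) (hs : Odd (Multiset.card s)) :
    Multiset.card s < 2 * Multiset.card (s.filter (multisetMedian s ≤ ·)) := by
  obtain ⟨r, hr⟩ := hs
  have h_sub : (((s.sort (· ≤ ·)).drop r : List ℝ) : Multiset ℝ) ≤
      s.filter (multisetMedian s ≤ ·) := by
    refine Multiset.le_filter.2 ⟨?_, fun a ha => ?_⟩
    · conv_rhs => rw [← Multiset.sort_eq s (· ≤ ·)]
      exact Multiset.coe_le.2 (List.drop_sublist r _).subperm
    · obtain ⟨k, hk, rfl⟩ := List.mem_iff_getElem.1 (Multiset.mem_coe.1 ha)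
      rw [List.getElem_drop, multisetMedian_eq_getElem s hr]
      exact (Multiset.pairwise_sort s (· ≤ ·)).sortedLE.getElem_le_getElem_of_le (by lia)
  have h_card := Multiset.card_le_card h_sub
  rw [Multiset.coe_card, List.length_drop, Multiset.length_sort] at h_card
  lia

/-- More than half of an odd multiset lies weakly below its median. -/
theorem card_lt_two_mul_card_filter_le_median (s : Multiset ℝ) (hs : Odd (Multiset.card s)) :
    Multiset.card s < 2 * Multiset.card (s.filter (· ≤ multisetMedian s)) := by
  obtain ⟨r, hr⟩ := hs
  have h_sub : (((s.sort (· ≤ ·)).take (r + 1) : List ℝ) : Multiset ℝ) ≤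
      s.filter (· ≤ multisetMedian s) := by
    refine Multiset.le_filter.2 ⟨?_, fun a ha => ?_⟩
    · conv_rhs => rw [← Multiset.sort_eq s (· ≤ ·)]
      exact Multiset.coe_le.2 (List.take_sublist (r + 1) _).subperm
    · obtain ⟨k, hk, rfl⟩ := List.mem_iff_getElem.1 (Multiset.mem_coe.1 ha)
      rw [List.length_take] at hk
      rw [List.getElem_take, multisetMedian_eq_getElem s hr]
      exact (Multiset.pairwise_sort s (· ≤ ·)).sortedLE.getElem_le_getElem_of_le (by lia)
  have h_card := Multiset.card_le_card h_sub
  rw [Multiset.coe_card, List.length_take, Multiset.length_sort] at h_card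
  lia

open Finset in
/-- A point `y > m` with a `1/2 - ε/8` fraction of the points weakly above it has social cost at
most `1 + ε` times that of `m`. -/
theorem socialCost_le_of_card_ge {n : ℕ} (x : Fin n → ℝ) {m y ε : ℝ} (hmy : m < y)
    (hε : 0 < ε) (hε1 : ε < 1) (h : (1 / 2 - ε / 8) * n ≤ #{i | y ≤ x i}) :
    socialCost x y ≤ (1 + ε) * socialCost x m := by
  set b : Fin n → ℝ := fun i => if y ≤ x i then 1 else 0
  have hb : ∑ i, b i = #{i | y ≤ x i} := by simp [b]
  have h_upper : socialCost x y ≤ socialCost x m + (y - m) * (n - 2 * ∑ i, b i) := by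
    have h_const : (y - m) * (n - 2 * ∑ i, b i) = ∑ i, ((y - m) - (y - m) * 2 * b i) := by
      rw [sum_sub_distrib, ← mul_sum]; simp; ring
    rw [h_const, socialCost, socialCost, ← sum_add_distrib]
    refine sum_le_sum fun i _ => ?_
    simp only [b]
    split_ifs with hi
    · rw [abs_of_nonneg (by linarith), abs_of_nonneg (by linarith)]; linarith
    · have := abs_sub_le (x i) m y
      rw [abs_of_neg (a := m - y) (by linarith)] at this
      linarith
  have h_lower : (y - m) * ∑ i, b i ≤ socialCost x m := by
    rw [mul_sum, socialCost]
    refine sum_le_sum fun i _ => ?_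
    simp only [b]
    split_ifs with hi
    · rw [abs_of_nonneg (by linarith)]; linarith
    · simp
  rw [← hb] at h
  have hd : 0 < y - m := by linarith
  have hn : (0 : ℝ) ≤ n := by positivity
  have h_gain : n - 2 * ∑ i, b i ≤ ε * ∑ i, b i := by
    nlinarith [mul_nonneg hn hε.le, mul_nonneg (mul_nonneg hn hε.le) (sub_nonneg.2 hε1.le)]
  nlinarith [mul_le_mul_of_nonneg_left h_gain hd.le, mul_le_mul_of_nonneg_left h_lower hε.le]

theorem socialCost_neg {n : ℕ} (x : Fin n → ℝ) (y : ℝ) :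
    socialCost (fun i => -x i) (-y) = socialCost x y := by
  refine Finset.sum_congr rfl fun i _ => ?_
  rw [← abs_neg]
  congr 1
  ring

open Finset in
/-- For every reference point `m` and every odd `c`, at most a fraction `128 / (c * ε ^ 2)` of the
`c`-subsets have a median of social cost more than `1 + ε` times that of `m`. -/
theorem card_median_socialCost_gt_le {n : ℕ} (hn : 0 < n) (x : Fin n → ℝ) (m : ℝ) {c : ℕ}
    (hc : Odd c) {ε : ℝ} (hε : 0 < ε) (hε1 : ε < 1) :
    (Nat.card {S : Finset (Fin n) // #S = c ∧
      socialCost x (multisetMedian (Multiset.map x S.val)) > (1 + ε) * socialCost x m} : ℝ)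
      ≤ 128 / (c * ε ^ 2) * n.choose c := by
  classical
  have : Nonempty (Fin n) := ⟨⟨0, hn⟩⟩
  let y : Finset (Fin n) → ℝ := fun S => multisetMedian (Multiset.map x S.val)
  let bad : Finset (Finset (Fin n)) :=
    {S | #S = c ∧ socialCost x (y S) > (1 + ε) * socialCost x m}
  have h_bad : ∀ S, S ∈ bad ↔ #S = c ∧ socialCost x (y S) > (1 + ε) * socialCost x m := by
    simp [bad]
  have h_card : Nat.card {S : Finset (Fin n) // #S = c ∧
      socialCost x (multisetMedian (Multiset.map x S.val)) > (1 + ε) * socialCost x m} = #bad := by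
    rw [Nat.card_eq_fintype_card, Fintype.card_subtype]
  have h_above := card_powersetCard_filter_tail_le x hc.pos (η := ε / 8) (by positivity)
    (by linarith) (bad.filter (m < y ·)) fun S hS => by
      obtain ⟨hS, hmy⟩ := mem_filter.1 hS
      obtain ⟨hSc, hcost⟩ := (h_bad S).1 hS
      refine ⟨hSc, y S, ?_, ?_⟩
      · have := card_lt_two_mul_card_filter_median_le (Multiset.map x S.val) (by simpa [hSc])
        rw [Multiset.card_map, Multiset.filter_map, Multiset.card_map] at this
        rw [← hSc]
        exact this
      · by_contra! h
        rw [Fintype.card_fin] at h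
        exact hcost.not_ge (socialCost_le_of_card_ge x hmy hε hε1 h)
  have h_below := card_powersetCard_filter_tail_le (fun i => -x i) hc.pos (η := ε / 8)
    (by positivity) (by linarith) (bad.filter (y · < m)) fun S hS => by
      obtain ⟨hS, hmy⟩ := mem_filter.1 hS
      obtain ⟨hSc, hcost⟩ := (h_bad S).1 hS
      refine ⟨hSc, -y S, ?_, ?_⟩
      · have := card_lt_two_mul_card_filter_le_median (Multiset.map x S.val) (by simpa [hSc])
        rw [Multiset.card_map, Multiset.filter_map, Multiset.card_map] at this
        simp only [neg_le_neg_iff]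
        rw [← hSc]
        exact this
      · by_contra! h
        rw [Fintype.card_fin] at h
        have := socialCost_le_of_card_ge (fun i => -x i) (neg_lt_neg hmy) hε hε1 h
        rw [socialCost_neg, socialCost_neg] at this
        exact hcost.not_ge this
  have h_union : bad ⊆ bad.filter (m < y ·) ∪ bad.filter (y · < m) := by
    intro S hS
    rcases lt_trichotomy m (y S) with h | h | h
    · exact mem_union_left _ (mem_filter.2 ⟨hS, h⟩)
    · have hcost := ((h_bad S).1 hS).2
      have h_nonneg : 0 ≤ socialCost x m := sum_nonneg fun i _ => abs_nonneg _
      rw [← h] at hcost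
      nlinarith
    · exact mem_union_right _ (mem_filter.2 ⟨hS, h⟩)
  have h_sum : (#bad : ℝ) ≤ #(bad.filter (m < y ·)) + #(bad.filter (y · < m)) := by
    exact_mod_cast (card_le_card h_union).trans (card_union_le _ _)
  rw [h_card]
  refine (h_sum.trans (add_le_add h_above h_below)).trans_eq ?_
  have hc' : (c : ℝ) ≠ 0 := by exact_mod_cast hc.pos.ne'
  rw [Fintype.card_fin]
  field_simp
  ring

/-- Sampling median on the line, high-probability version: there is `K > 0` such that for all
`ε, δ ∈ (0,1)` and every odd sample size `c ≥ K/(εδ)²`, and for every sequence of instances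
`x κ : Fin (2κ+1) → ℝ`, the probability (over a uniformly random `c`-element subset `S` of the
agents) that the social cost of the sample median exceeds `(1+ε)` times the social cost of the
full-information median is at most `δ` in the limit `n = 2κ+1 → ∞` (limsup over `κ`). -/
theorem stmt_10 :
    ∃ K : ℝ, 0 < K ∧ ∀ ε : ℝ, 0 < ε → ε < 1 → ∀ δ : ℝ, 0 < δ → δ < 1 →
      ∀ c : ℕ, Odd c → K / (ε * δ) ^ 2 ≤ (c : ℝ) →
      ∀ x : (κ : ℕ) → Fin (2 * κ + 1) → ℝ,
        limsup (fun κ : ℕ =>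
            ((Nat.card {S : Finset (Fin (2 * κ + 1)) // S.card = c ∧
                socialCost (x κ) (multisetMedian (Multiset.map (x κ) S.val)) >
                  (1 + ε) * socialCost (x κ)
                    (multisetMedian (Multiset.map (x κ) Finset.univ.val))} : ℝ)
              / ((2 * κ + 1).choose c : ℝ)))
          atTop ≤ δ := by
  refine ⟨128, by norm_num, fun ε hε hε1 δ hδ hδ1 c hc hcK x => ?_⟩
  refine limsup_le_of_le
    (IsBoundedUnder.isCoboundedUnder_le (isBoundedUnder_of ⟨0, fun κ => by positivity⟩))
    (Eventually.of_forall fun κ => ?_)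
  refine div_le_of_le_mul₀ (by positivity) hδ.le
    ((card_median_socialCost_gt_le (Nat.succ_pos _) (x κ) _ hc hε hε1).trans ?_)
  have hc' : (0 : ℝ) < c := by exact_mod_cast hc.pos
  refine mul_le_mul_of_nonneg_right ?_ (by positivity)
  rw [div_le_iff₀ (by positivity)] at hcK ⊢
  have h_sq : (c : ℝ) * (ε * δ) ^ 2 ≤ δ * (c * ε ^ 2) := by
    have : 0 ≤ (c : ℝ) * ε ^ 2 * δ := by positivity
    nlinarith
  exact hcK.trans h_sq
end

section
/- Let (M, d) be a metric space equipped with a linear order ≤ such that for all a, b, c ∈ M with a ≤ b ≤ c one has d(a, c) = d(a, b) + d(b, c) (as holds for the arc-length distance on a simple open curve). There exists a constant K > 0 with the following property. For every ε > 0 and every odd integer c ≥ K/ε², and for every sequence of instances where the n-th instance consists of points x^{(n)}_1, …, x^{(n)}_n ∈ M (n odd, n ≥ c) whose median x_m^{(n)} (with respect to the order ≤) has positive social cost: limsup_{n→∞, n odd} E_S[ SC_n( median of (x^{(n)}_i)_{i∈S} ) ] / SC_n(x_m^{(n)}) ≤ 1 + ε, where S is a uniformly random c-element subset of {1, …, n}.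 -/
open Filter

/-- The median (w.r.t. a linear order) of a multiset of odd size `2κ+1`:
its `(κ+1)`-th smallest element. -/
noncomputable def multisetMedianOrd {M : Type*} [LinearOrder M] [Inhabited M]
    (s : Multiset M) : M :=
  (s.sort (· ≤ ·)).getD ((Multiset.card s - 1) / 2) default

/-- The social cost of `y` w.r.t. points `x 1, …, x n` in a metric space. -/
noncomputable def socialCostM {M : Type*} [MetricSpace M] {n : ℕ} (x : Fin n → M) (y : M) :
    ℝ := ∑ i, dist (x i) y

open Finset in
/-- The first moment of the size of the trace on `B` of a random `c`-element set. -/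
theorem card_mul_sum_card_inter_powersetCard {α : Type*} [Fintype α] [DecidableEq α]
    (B : Finset α) {c : ℕ} (hc : 0 < c) (hcn : c ≤ Fintype.card α) :
    Fintype.card α * ∑ S ∈ powersetCard c (univ : Finset α), #(S ∩ B)
      = #B * c * (Fintype.card α).choose c := by
  have h1 : ∑ S ∈ powersetCard c (univ : Finset α), #(S ∩ B)
      = ∑ i ∈ B, #{S ∈ powersetCard c (univ : Finset α) | {i} ⊆ S} := by
    simp only [card_eq_sum_ones, sum_filter, singleton_subset_iff]
    rw [sum_comm]
    refine sum_congr rfl fun S _ => ?_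
    rw [← sum_filter, filter_mem_eq_inter, inter_comm]
  have h2 (i : α) : #{S ∈ powersetCard c (univ : Finset α) | {i} ⊆ S}
      = (Fintype.card α - 1).choose (c - 1) := by
    rw [card_filter_powersetCard_subset _ _ _ (subset_univ _) (by simpa [Nat.one_le_iff_ne_zero] using hc.ne')]
    simp
  simp only [h1, h2, sum_const, smul_eq_mul]
  obtain ⟨c, rfl⟩ := Nat.exists_eq_succ_of_ne_zero hc.ne'
  obtain ⟨n, hn⟩ := Nat.exists_eq_succ_of_ne_zero (by omega : Fintype.card α ≠ 0)
  rw [hn]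
  have := Nat.add_one_mul_choose_eq n c
  simp only [Nat.succ_eq_add_one, Nat.add_sub_cancel]
  linear_combination #B * this

open Finset in
/-- The number of `c`-element sets containing two given points. -/
theorem card_mul_card_filter_pair_subset {α : Type*} [Fintype α] [DecidableEq α]
    {c : ℕ} (hc : 0 < c) (hcn : c ≤ Fintype.card α) {i j : α} (hij : i ≠ j) :
    (Fintype.card α : ℝ) * (Fintype.card α - 1)
        * #{S ∈ powersetCard c (univ : Finset α) | {i, j} ⊆ S}
      = c * (c - 1) * (Fintype.card α).choose c := by
  obtain rfl | hc2 : c = 1 ∨ 2 ≤ c := by omega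
  · have : #{S ∈ powersetCard 1 (univ : Finset α) | {i, j} ⊆ S} = 0 := by
      rw [card_eq_zero, filter_eq_empty_iff]
      intro S hS hsub
      have := card_le_card hsub
      rw [card_pair hij, (mem_powersetCard.1 hS).2] at this
      omega
    simp [this]
  · rw [card_filter_powersetCard_subset _ _ _ (subset_univ _) (by rwa [card_pair hij]),
      card_pair hij, card_univ]
    obtain ⟨c, rfl⟩ := Nat.exists_eq_add_of_le' hc2
    obtain ⟨n, hn⟩ := Nat.exists_eq_add_of_le' (hc2.trans hcn)
    rw [hn]
    have e1 := Nat.add_one_mul_choose_eq (n + 1) (c + 1)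
    have e2 := Nat.add_one_mul_choose_eq n c
    simp only [Nat.add_sub_cancel]
    have e1' : ((n : ℝ) + 1 + 1) * (n + 1).choose (c + 1)
      = (n + 2).choose (c + 2) * (c + 1 + 1) := by exact_mod_cast e1
    have e2' : ((n : ℝ) + 1) * n.choose c = (n + 1).choose (c + 1) * (c + 1) := by
      exact_mod_cast e2
    push_cast
    linear_combination (n + 2 : ℝ) * e2' + (c + 1 : ℝ) * e1'

open Finset in
/-- An upper bound on the second moment of the size of the trace on `B` of a random
`c`-element set. -/
theorem card_sq_mul_sum_card_inter_sq_le {α : Type*} [Fintype α] [DecidableEq α]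
    (B : Finset α) {c : ℕ} (hc : 0 < c) (hcn : c ≤ Fintype.card α) :
    (Fintype.card α : ℝ) ^ 2 * ∑ S ∈ powersetCard c (univ : Finset α), (#(S ∩ B) : ℝ) ^ 2
      ≤ (Fintype.card α).choose c * (c * #B * Fintype.card α + c * (c - 1) * #B ^ 2) := by
  set n := Fintype.card α with hn
  have hn0 : (0 : ℝ) < n := by exact_mod_cast hc.trans_le hcn
  have hc1 : (1 : ℝ) ≤ c := by exact_mod_cast hc
  have hbn : (#B : ℝ) ≤ n := by exact_mod_cast card_le_univ B
  have hX (S : Finset α) : (#(S ∩ B) : ℝ) = ∑ i ∈ B, if i ∈ S then 1 else 0 := by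
    rw [← sum_filter, filter_mem_eq_inter, inter_comm]; simp
  have hsq : ∑ S ∈ powersetCard c (univ : Finset α), (#(S ∩ B) : ℝ) ^ 2
      = ∑ i ∈ B, ∑ j ∈ B, (#{S ∈ powersetCard c (univ : Finset α) | {i, j} ⊆ S} : ℝ) := by
    simp only [pow_two, hX, sum_mul_sum]
    rw [sum_comm]
    refine sum_congr rfl fun i _ => ?_
    rw [sum_comm]
    refine sum_congr rfl fun j _ => ?_
    rw [card_filter]
    push_cast
    refine sum_congr rfl fun S _ => ?_
    by_cases hi : i ∈ S <;> by_cases hj : j ∈ S <;> simp [insert_subset_iff, hi, hj]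
  have hfirst : (n : ℝ) * ∑ i ∈ B, (#{S ∈ powersetCard c (univ : Finset α) | {i, i} ⊆ S} : ℝ)
      = #B * c * n.choose c := by
    rw [← Nat.cast_sum]
    have := card_mul_sum_card_inter_powersetCard B hc hcn
    rw [← hn] at this
    rw [← Nat.cast_mul, ← Nat.cast_mul, ← Nat.cast_mul, ← this]
    congr 2
    simp only [card_eq_sum_ones, sum_filter, pair_eq_singleton, singleton_subset_iff]
    rw [sum_comm]
    refine sum_congr rfl fun S _ => ?_
    rw [← sum_filter, filter_mem_eq_inter, inter_comm]
  have hoff : ∀ i ∈ B, (n : ℝ) ^ 2 *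
      ∑ j ∈ B.erase i, (#{S ∈ powersetCard c (univ : Finset α) | {i, j} ⊆ S} : ℝ)
        ≤ n.choose c * (c * (c - 1) * #B) := by
    intro i hi
    obtain hb | hb : #B = 1 ∨ 2 ≤ #B := by
      have := card_pos.2 ⟨i, hi⟩
      omega
    · have : B.erase i = ∅ := by rw [← card_eq_zero, card_erase_of_mem hi, hb]
      rw [this, sum_empty, mul_zero]
      have : (0 : ℝ) ≤ c - 1 := by linarith
      positivity
    · have hb2 : (2 : ℝ) ≤ #B := by exact_mod_cast hb
      have hpair : ∀ j ∈ B.erase i,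
          (#{S ∈ powersetCard c (univ : Finset α) | {i, j} ⊆ S} : ℝ)
            = c * (c - 1) * n.choose c / (n * (n - 1)) := by
        intro j hj
        have hn1 : (n : ℝ) - 1 ≠ 0 := by linarith
        rw [eq_div_iff (mul_ne_zero hn0.ne' hn1), mul_comm]
        exact card_mul_card_filter_pair_subset hc hcn (ne_of_mem_erase hj).symm
      rw [sum_congr rfl hpair, sum_const, card_erase_of_mem hi, nsmul_eq_mul,
        Nat.cast_sub (by omega), Nat.cast_one]
      have hn1 : (0 : ℝ) < n - 1 := by linarith
      have hfrac : ((#B : ℝ) - 1) * n / (n - 1) ≤ #B := by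
        rw [div_le_iff₀ hn1]; linarith
      calc (n : ℝ) ^ 2 * ((#B - 1) * (c * (c - 1) * n.choose c / (n * (n - 1))))
          = n.choose c * (c * (c - 1)) * ((#B - 1) * n / (n - 1)) := by
            field_simp
        _ ≤ n.choose c * (c * (c - 1)) * #B := by
            have : (0 : ℝ) ≤ c - 1 := by linarith
            gcongr
        _ = _ := by ring
  rw [hsq]
  have hsplit : ∑ i ∈ B, ∑ j ∈ B, (#{S ∈ powersetCard c (univ : Finset α) | {i, j} ⊆ S} : ℝ)
      = ∑ i ∈ B, (#{S ∈ powersetCard c (univ : Finset α) | {i, i} ⊆ S} : ℝ)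
        + ∑ i ∈ B, ∑ j ∈ B.erase i,
          (#{S ∈ powersetCard c (univ : Finset α) | {i, j} ⊆ S} : ℝ) := by
    rw [← sum_add_distrib]
    exact sum_congr rfl fun i hi => (add_sum_erase _ _ hi).symm
  have hsum := sum_le_sum hoff
  rw [← mul_sum, sum_const, nsmul_eq_mul] at hsum
  rw [hsplit, mul_add]
  linear_combination hsum + (n : ℝ) * hfirst

open Finset in
/-- A minority `B` obtains a majority in few samples: the excess cost is at most an `ε`-fraction
of the size of the minority. -/
theorem sub_mul_card_filter_majority_le {α : Type*} [Fintype α] [DecidableEq α]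
    (B : Finset α) {c : ℕ} (hc : 0 < c) (hcn : c ≤ Fintype.card α)
    (hB : 2 * #B ≤ Fintype.card α) {ε : ℝ} (hε : 0 < ε) (hcε : 8 / ε ^ 2 ≤ c) :
    ((Fintype.card α : ℝ) - 2 * #B)
        * #{S ∈ powersetCard c (univ : Finset α) | c < 2 * #(S ∩ B)}
      ≤ ε * #B * (Fintype.card α).choose c := by
  have hfirst := card_mul_sum_card_inter_powersetCard B hc hcn
  have hsecond := card_sq_mul_sum_card_inter_sq_le B hc hcn
  set n := Fintype.card α with hn
  set P := powersetCard c (univ : Finset α) with hP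
  set bad := {S ∈ P | c < 2 * #(S ∩ B)} with hbad
  have hfirst' : (n : ℝ) * ∑ S ∈ P, (#(S ∩ B) : ℝ) = #B * c * n.choose c := by
    exact_mod_cast hfirst
  have hn0 : (0 : ℝ) < n := by exact_mod_cast hc.trans_le hcn
  have hc0 : (0 : ℝ) < c := by exact_mod_cast hc
  have hB' : (0 : ℝ) ≤ n - 2 * #B := by
    have : (2 * #B : ℝ) ≤ n := by exact_mod_cast hB
    linarith
  have hcard : (#P : ℝ) = n.choose c := by simp [hP, hn]
  have hmem : ∀ S ∈ bad, (c : ℝ) ≤ 2 * #(S ∩ B) := fun S hS => by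
    exact_mod_cast (mem_filter.1 hS).2.le
  have hmarkov : (#bad : ℝ) * n ≤ 2 * #B * n.choose c := by
    have h : (#bad : ℝ) * c ≤ 2 * ∑ S ∈ P, (#(S ∩ B) : ℝ) := by
      rw [← nsmul_eq_mul, ← sum_const, mul_sum]
      exact (sum_le_sum hmem).trans
        (sum_le_sum_of_subset_of_nonneg (filter_subset _ _) fun _ _ _ => by positivity)
    refine le_of_mul_le_mul_right ?_ hc0
    linear_combination (n : ℝ) * h + 2 * hfirst'
  have hchebyshev : (#bad : ℝ) * c * (n - 2 * #B) ^ 2 ≤ 4 * n * #B * n.choose c := by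
    have hvar : ∑ S ∈ P, ((n : ℝ) * #(S ∩ B) - c * #B) ^ 2 ≤ n.choose c * c * #B * n := by
      have hexp : ∑ S ∈ P, ((n : ℝ) * #(S ∩ B) - c * #B) ^ 2
          = n ^ 2 * ∑ S ∈ P, (#(S ∩ B) : ℝ) ^ 2
            - 2 * c * #B * (n * ∑ S ∈ P, (#(S ∩ B) : ℝ)) + n.choose c * (c * #B) ^ 2 := by
        rw [← hcard, ← nsmul_eq_mul (#P), ← sum_const, mul_sum, mul_sum, mul_sum,
          ← sum_sub_distrib, ← sum_add_distrib]
        exact sum_congr rfl fun S _ => by ring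
      rw [hexp, hfirst']
      have : (0 : ℝ) ≤ n.choose c * c * #B ^ 2 := by positivity
      linear_combination hsecond + this
    have hdev : ∀ S ∈ bad,
        ((c : ℝ) * (n - 2 * #B)) ^ 2 ≤ 4 * ((n : ℝ) * #(S ∩ B) - c * #B) ^ 2 := by
      intro S hS
      have h := mul_le_mul_of_nonneg_left (hmem S hS) hn0.le
      have h0 : 0 ≤ (c : ℝ) * (n - 2 * #B) := by positivity
      calc ((c : ℝ) * (n - 2 * #B)) ^ 2 ≤ (2 * ((n : ℝ) * #(S ∩ B) - c * #B)) ^ 2 :=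
            pow_le_pow_left₀ h0 (by linarith) 2
        _ = _ := by ring
    have h : (#bad : ℝ) * (c * (n - 2 * #B)) ^ 2
        ≤ 4 * ∑ S ∈ P, ((n : ℝ) * #(S ∩ B) - c * #B) ^ 2 := by
      rw [← nsmul_eq_mul, ← sum_const, mul_sum]
      exact (sum_le_sum hdev).trans
        (sum_le_sum_of_subset_of_nonneg (filter_subset _ _) fun _ _ _ => by positivity)
    refine le_of_mul_le_mul_right ?_ hc0
    linear_combination h + 4 * hvar
  obtain hsmall | hlarge := le_or_gt (2 * ((n : ℝ) - 2 * #B)) (ε * n)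
  · have h1 := mul_le_mul_of_nonneg_right hsmall (Nat.cast_nonneg (α := ℝ) #bad)
    have h2 := mul_le_mul_of_nonneg_left hmarkov hε.le
    linarith
  · have hcε' : 8 ≤ c * ε ^ 2 := (div_le_iff₀ (by positivity)).1 hcε
    have h1 : (#bad : ℝ) * c * (n - 2 * #B) * (ε * n) ≤ 8 * n * #B * n.choose c := by
      have := mul_le_mul_of_nonneg_left hlarge.le
        (by positivity : 0 ≤ (#bad : ℝ) * c * (n - 2 * #B))
      linear_combination this + 2 * hchebyshev
    have h2 : 8 * ((n : ℝ) * #B * n.choose c) ≤ c * ε ^ 2 * (n * #B * n.choose c) := by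
      gcongr
    refine le_of_mul_le_mul_right ?_ (by positivity : 0 < c * ε * n)
    linear_combination h1 + h2

open Finset in
/-- Deciding membership in `A` by the majority of a random sample of odd size: the expected number
of points that disagree with the decision is at most `1 + ε` times the minimal one. -/
theorem sum_card_disagree_majority_le {α : Type*} [Fintype α] [DecidableEq α]
    (A : Finset α) {c : ℕ} (hc : Odd c) (hcn : c ≤ Fintype.card α)
    {ε : ℝ} (hε : 0 < ε) (hcε : 8 / ε ^ 2 ≤ c) :
    ∑ S ∈ powersetCard c (univ : Finset α), (#{i | ¬(i ∈ A ↔ c < 2 * #(S ∩ A))} : ℝ)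
      ≤ (1 + ε) * (Fintype.card α).choose c
        * #{i | ¬(i ∈ A ↔ Fintype.card α < 2 * #A)} := by
  have key (B : Finset α) (hB : 2 * #B ≤ Fintype.card α) :
      ∑ S ∈ powersetCard c (univ : Finset α), (#{i | ¬(i ∈ B ↔ c < 2 * #(S ∩ B))} : ℝ)
        ≤ (1 + ε) * (Fintype.card α).choose c * #B := by
    have h := sub_mul_card_filter_majority_le B hc.pos hcn hB hε hcε
    have hterm (S : Finset α) : (#{i | ¬(i ∈ B ↔ c < 2 * #(S ∩ B))} : ℝ)
        = #B + ((Fintype.card α : ℝ) - 2 * #B) * if c < 2 * #(S ∩ B) then 1 else 0 := by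
      by_cases hS : c < 2 * #(S ∩ B)
      · have : ({i | ¬(i ∈ B ↔ c < 2 * #(S ∩ B))} : Finset α) = Bᶜ := by ext; simp [hS]
        rw [this, card_compl, Nat.cast_sub (card_le_univ B), if_pos hS]
        ring
      · simp [hS]
    simp only [hterm]
    rw [sum_add_distrib, ← mul_sum, ← sum_filter, sum_const, sum_const, card_powersetCard,
      card_univ, nsmul_eq_mul, nsmul_eq_mul, mul_one]
    linarith
  obtain hA | hA := le_or_gt (2 * #A) (Fintype.card α)
  · have := key A hA
    have hset : ({i | ¬(i ∈ A ↔ Fintype.card α < 2 * #A)} : Finset α) = A := by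
      ext; simp [hA.not_gt]
    rwa [hset]
  · have hcompl := card_add_card_compl A
    have := key Aᶜ (by omega)
    have hset : ({i | ¬(i ∈ A ↔ Fintype.card α < 2 * #A)} : Finset α) = Aᶜ := by
      ext; simp [hA]
    rw [hset]
    refine le_of_eq_of_le (sum_congr rfl fun S hS => ?_) this
    have hS' : #(S ∩ A) + #(S ∩ Aᶜ) = c := by
      rw [← (mem_powersetCard.1 hS).2, ← sdiff_eq_inter_compl, add_comm]
      exact card_sdiff_add_card_inter S A
    obtain ⟨k, rfl⟩ := hc
    have hiff : 2 * k + 1 < 2 * #(S ∩ Aᶜ) ↔ ¬ 2 * k + 1 < 2 * #(S ∩ A) := by omega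
    congr 2
    ext i
    simp only [mem_filter, mem_univ, true_and, mem_compl, hiff, not_iff_not]

open Finset in
/-- The `k`-th smallest element of `S` is at most `t` iff more than `k` elements of `S` are. -/
theorem orderEmbOfFin_le_iff_lt_card_filter {α : Type*} [LinearOrder α] (S : Finset α) {c : ℕ}
    (h : #S = c) (k : Fin c) (t : α) :
    S.orderEmbOfFin h k ≤ t ↔ (k : ℕ) < #{i ∈ S | i ≤ t} := by
  have hcard : #{i ∈ S | i ≤ t} = #{j : Fin c | S.orderEmbOfFin h j ≤ t} := by
    conv_lhs => rw [← map_orderEmbOfFin_univ S h, filter_map, card_map]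
    rfl
  rw [hcard]
  constructor
  · intro hk
    calc (k : ℕ) < #(Iic k) := by simp
      _ ≤ _ := card_le_card fun j hj => by
        simpa using ((S.orderEmbOfFin h).monotone (mem_Iic.1 hj)).trans hk
  · intro hk
    by_contra hlt
    refine hk.not_ge ?_
    calc _ ≤ #(Iio k) := card_le_card fun j hj => by
          rw [mem_Iio]
          by_contra hjk
          exact hlt (((S.orderEmbOfFin h).monotone (not_lt.1 hjk)).trans (mem_filter.1 hj).2)
      _ = k := by simp

/-- A monotone family sends the median index of `S` to the median of its values on `S`. -/
theorem multisetMedianOrd_map_of_monotone {M ι : Type*} [LinearOrder M] [Inhabited M]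
    [LinearOrder ι] {y : ι → M} (hy : Monotone y) (S : Finset ι) {c : ℕ} (h : S.card = c)
    (hc : 0 < c) :
    multisetMedianOrd (Multiset.map y S.val)
      = y (S.orderEmbOfFin h ⟨(c - 1) / 2, by omega⟩) := by
  have hsort : (Multiset.map y S.val).sort (· ≤ ·) = S.sort.map y := by
    refine List.Perm.eq_of_pairwise' (Multiset.pairwise_sort _ _) ?_ ?_
    · exact (S.pairwise_sort (· ≤ ·)).map y fun a b hab => hy hab
    · rw [← Multiset.coe_eq_coe, Multiset.sort_eq, ← Multiset.map_coe, Finset.sort_eq]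
  have hlen : (c - 1) / 2 < (S.sort.map y).length := by
    rw [List.length_map, Finset.length_sort, h]
    omega
  rw [multisetMedianOrd, hsort, Multiset.card_map, Finset.card_val, h,
    List.getD_eq_getElem _ _ hlen, List.getElem_map, Finset.orderEmbOfFin_apply]
  rfl

/-- The distance between two points of a monotone sequence is the sum of the gaps that
separate them. -/
theorem dist_eq_sum_gaps {M : Type*} [MetricSpace M] [LinearOrder M]
    (hadd : ∀ a b c : M, a ≤ b → b ≤ c → dist a c = dist a b + dist b c)
    {y : ℕ → M} (hy : Monotone y) {N i j : ℕ} (hi : i ≤ N) (hj : j ≤ N) :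
    dist (y i) (y j) = ∑ t ∈ Finset.range N,
      dist (y t) (y (t + 1)) * if ¬(i ≤ t ↔ j ≤ t) then 1 else 0 := by
  wlog hij : i ≤ j generalizing i j
  · rw [dist_comm, this hj hi (le_of_not_ge hij)]
    simp only [iff_comm]
  have htel : dist (y i) (y j) = ∑ t ∈ Finset.Ico i j, dist (y t) (y (t + 1)) := by
    clear hj
    induction j, hij using Nat.le_induction with
    | base => simp
    | succ j hij ih =>
      rw [Finset.sum_Ico_succ_top hij, ← ih]
      exact hadd _ _ _ (hy hij) (hy j.le_succ)
  simp only [mul_ite, mul_one, mul_zero]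
  rw [htel, ← Finset.sum_filter]
  congr 1
  ext t
  simp only [Finset.mem_Ico, Finset.mem_filter, Finset.mem_range]
  omega

open Finset in
/-- The expected social cost of the sample median, for points listed in increasing order. -/
theorem sum_socialCostM_le_of_monotone {M : Type*} [MetricSpace M] [LinearOrder M] [Inhabited M]
    (hadd : ∀ a b c : M, a ≤ b → b ≤ c → dist a c = dist a b + dist b c)
    {κ : ℕ} {y : Fin (2 * κ + 1) → M} (hy : Monotone y) {c : ℕ} (hc : Odd c)
    (hcn : c ≤ 2 * κ + 1) {ε : ℝ} (hε : 0 < ε) (hcε : 8 / ε ^ 2 ≤ c) :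
    ∑ S ∈ powersetCard c (univ : Finset (Fin (2 * κ + 1))),
        socialCostM y (multisetMedianOrd (Multiset.map y S.val))
      ≤ (1 + ε) * (2 * κ + 1).choose c
        * socialCostM y (multisetMedianOrd (Multiset.map y univ.val)) := by
  set z : ℕ → M := fun t => y ⟨min t (2 * κ), by omega⟩ with hz
  have hzmono : Monotone z := fun a b hab => hy (Fin.mk_le_mk.2 (min_le_min_right _ hab))
  have hyz (i : Fin (2 * κ + 1)) : y i = z i := by
    simp only [hz]
    congr 1
    ext
    simp only
    omega
  set A : ℕ → Finset (Fin (2 * κ + 1)) := fun t => {i | (i : ℕ) ≤ t} with hA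
  have hcost (S : Finset (Fin (2 * κ + 1))) {d : ℕ} (hd : Odd d) (hS : #S = d) :
      socialCostM y (multisetMedianOrd (Multiset.map y S.val))
        = ∑ t ∈ range (2 * κ), dist (z t) (z (t + 1))
            * (#{i | ¬(i ∈ A t ↔ d < 2 * #(S ∩ A t))} : ℝ) := by
    rw [multisetMedianOrd_map_of_monotone hy S hS hd.pos, socialCostM]
    set m := S.orderEmbOfFin hS ⟨(d - 1) / 2, by have := hd.pos; omega⟩ with hm
    have hmt : ∀ t ∈ range (2 * κ), (m : ℕ) ≤ t ↔ d < 2 * #(S ∩ A t) := by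
      intro t ht
      have ht' : t < 2 * κ + 1 := by rw [mem_range] at ht; omega
      have h := orderEmbOfFin_le_iff_lt_card_filter S hS
        ⟨(d - 1) / 2, by have := hd.pos; omega⟩ ⟨t, ht'⟩
      have hset : S ∩ A t = {i ∈ S | i ≤ (⟨t, ht'⟩ : Fin (2 * κ + 1))} := by
        ext i; simp [hA, Fin.le_def]
      rw [← hm, Fin.le_def] at h
      rw [hset, h]
      obtain ⟨k, rfl⟩ := hd
      simp only
      omega
    have hdist (i : Fin (2 * κ + 1)) := dist_eq_sum_gaps hadd hzmono
      (N := 2 * κ) (Nat.le_of_lt_succ i.isLt) (Nat.le_of_lt_succ m.isLt)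
    simp only [hyz, hdist]
    rw [sum_comm]
    refine sum_congr rfl fun t ht => ?_
    rw [← mul_sum, card_filter]
    push_cast
    congr 1
    refine sum_congr rfl fun i _ => ?_
    simp [hA, hmt t ht]
  rw [hcost univ (d := 2 * κ + 1) ⟨κ, rfl⟩ (by simp),
    sum_congr rfl fun S hS => hcost S hc (mem_powersetCard.1 hS).2, sum_comm, mul_sum]
  refine sum_le_sum fun t _ => ?_
  have h := sum_card_disagree_majority_le (A t) hc (by simpa using hcn) hε hcε
  rw [Fintype.card_fin] at h
  rw [← mul_sum, univ_inter, mul_left_comm]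
  exact mul_le_mul_of_nonneg_left h dist_nonneg

open Finset in
/-- The expected social cost of the sample median. -/
theorem sum_socialCostM_le {M : Type*} [MetricSpace M] [LinearOrder M] [Inhabited M]
    (hadd : ∀ a b c : M, a ≤ b → b ≤ c → dist a c = dist a b + dist b c)
    {κ : ℕ} (x : Fin (2 * κ + 1) → M) {c : ℕ} (hc : Odd c)
    (hcn : c ≤ 2 * κ + 1) {ε : ℝ} (hε : 0 < ε) (hcε : 8 / ε ^ 2 ≤ c) :
    ∑ S ∈ powersetCard c (univ : Finset (Fin (2 * κ + 1))),
        socialCostM x (multisetMedianOrd (Multiset.map x S.val))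
      ≤ (1 + ε) * (2 * κ + 1).choose c
        * socialCostM x (multisetMedianOrd (Multiset.map x univ.val)) := by
  set σ := Tuple.sort x
  have h := sum_socialCostM_le_of_monotone hadd (Tuple.monotone_sort x) hc hcn hε hcε
  have hsc (p : M) : socialCostM (x ∘ σ) p = socialCostM x p :=
    Equiv.sum_comp σ fun i => dist (x i) p
  have hmap (S : Finset (Fin (2 * κ + 1))) :
      Multiset.map (x ∘ σ) S.val = Multiset.map x (S.map σ.toEmbedding).val := by
    simp [Multiset.map_map]
  have hP : powersetCard c (univ : Finset (Fin (2 * κ + 1)))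
      = (powersetCard c univ).map (mapEmbedding σ.toEmbedding).toEmbedding := by
    rw [← powersetCard_map, map_univ_equiv]
  rw [hP, sum_map]
  change ∑ S ∈ powersetCard c univ, socialCostM (x ∘ σ) (multisetMedianOrd
    (Multiset.map (x ∘ σ) S.val)) ≤ _ * socialCostM (x ∘ σ) (multisetMedianOrd
    (Multiset.map (x ∘ σ) univ.val)) at h
  simp only [hsc, hmap, map_univ_equiv] at h
  exact h

/-- Sampling median on a linearly ordered metric space in which the distance is additive along
the order (as for the arc-length distance on a simple open curve): there is `K > 0` such that
for every `ε > 0` and every odd sample size `c ≥ K/ε²`, and for every sequence of instances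
whose median has positive social cost, the expected social cost of the median of a uniformly
random `c`-element subset of agents is at most `(1+ε)` times optimal as `n = 2κ+1 → ∞`. -/
theorem stmt_12 (M : Type*) [MetricSpace M] [LinearOrder M] [Inhabited M]
    (hadd : ∀ a b c : M, a ≤ b → b ≤ c → dist a c = dist a b + dist b c) :
    ∃ K : ℝ, 0 < K ∧ ∀ ε : ℝ, 0 < ε → ∀ c : ℕ, Odd c → K / ε ^ 2 ≤ (c : ℝ) →
      ∀ x : (κ : ℕ) → Fin (2 * κ + 1) → M,
        (∀ κ : ℕ, c ≤ 2 * κ + 1 →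
          0 < socialCostM (x κ) (multisetMedianOrd (Multiset.map (x κ) Finset.univ.val))) →
        limsup (fun κ : ℕ =>
            ((∑ S ∈ Finset.powersetCard c (Finset.univ : Finset (Fin (2 * κ + 1))),
                socialCostM (x κ) (multisetMedianOrd (Multiset.map (x κ) S.val)))
              / ((2 * κ + 1).choose c : ℝ))
            / socialCostM (x κ) (multisetMedianOrd (Multiset.map (x κ) Finset.univ.val)))
          atTop ≤ 1 + ε := by
  refine ⟨8, by norm_num, fun ε hε c hc hcε x hpos => ?_⟩
  refine limsup_le_of_le ?_ ?_
  · refine (isBoundedUnder_of ⟨0, fun κ => ?_⟩ :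
      IsBoundedUnder (· ≥ ·) atTop _).isCoboundedUnder_le
    have hsc (p : M) : 0 ≤ socialCostM (x κ) p := Finset.sum_nonneg fun _ _ => dist_nonneg
    exact div_nonneg (div_nonneg (Finset.sum_nonneg fun _ _ => hsc _) (Nat.cast_nonneg _)) (hsc _)
  · filter_upwards [eventually_ge_atTop c] with κ hκ
    have hcn : c ≤ 2 * κ + 1 := by omega
    have hchoose : (0 : ℝ) < (2 * κ + 1).choose c := by exact_mod_cast Nat.choose_pos hcn
    rw [div_le_iff₀ (hpos κ hcn), div_le_iff₀ hchoose]
    linarith [sum_socialCostM_le hadd (x κ) hc hcn hε hcε]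
end

section
/- Let (M, d) be a metric space, let x_1, …, x_n ∈ M with n ≥ 1, and let y ∈ M be arbitrary. Then (1/n) · ∑_{j=1}^n ∑_{i=1}^n d(x_i, x_j) ≤ 2 · ∑_{i=1}^n d(x_i, y). In particular, the RandomDictator mechanism—which allocates the facility at the location of a uniformly random agent—yields in expectation at most a 2 approximation with respect to the optimal social cost, on any metric space. -/
/-- RandomDictator is a 2-approximation on any metric space: for points `x 1, …, x n` and any
`y`, the expected social cost of a uniformly random dictator, `(1/n)·∑_j ∑_i d(x_i, x_j)`, is
at most `2·∑_i d(x_i, y)`; in particular at most twice the optimal social cost. -/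
theorem stmt_14 {M : Type*} [MetricSpace M] (n : ℕ) (hn : 1 ≤ n)
    (x : Fin n → M) (y : M) :
    (1 / (n : ℝ)) * ∑ j, ∑ i, dist (x i) (x j) ≤ 2 * ∑ i, dist (x i) y := by
  have hn' : (0 : ℝ) < n := by exact_mod_cast hn
  have key : ∑ j, ∑ i, dist (x i) (x j) ≤ 2 * (∑ i, dist (x i) y) * n :=
    calc ∑ j, ∑ i, dist (x i) (x j)
        ≤ ∑ j, ∑ i, (dist (x i) y + dist (x j) y) :=
          Finset.sum_le_sum fun j _ => Finset.sum_le_sum fun i _ => dist_triangle_right _ _ _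
      _ = 2 * (∑ i, dist (x i) y) * n := by
          simp only [Finset.sum_add_distrib, Finset.sum_const, Finset.card_univ,
            Fintype.card_fin, nsmul_eq_mul, ← Finset.mul_sum]
          ring
  rw [one_div_mul_eq_div]
  exact (div_le_iff₀ hn').2 key
end

section
/- Let n agents be single-minded over m ≥ 2 candidates: agent i's preferred candidate is u(i) ∈ {1, …, m}, and the social welfare of candidate j is SW(j) = #{i : u(i) = j}; write s_j = SW(j)/n and let j* maximize SW. Draw c agents independently and uniformly at random with replacement, and let r be a candidate receiving the most votes among the sampled agents (a plurality winner of the sample, ties broken arbitrarily). For every ε ∈ (0, 1) and δ ∈ (0, 1), if c ≥ 2m²·log(2m/δ)/ε², then with probability at least 1 − δ: SW(r) ≥ (1 − ε)·SW(j*). -/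
/-- Chernoff-type counting bound: the number of samples in which `b` gets at least as many votes
as `a` is at most the power of the total weight, where `b`-voters have weight `q⁻¹` and `a`-voters
have weight `q`. -/
theorem card_samples_le_pow {ι κ τ : Type*} [Fintype ι] [Fintype τ] [DecidableEq κ]
    [DecidableEq τ] (u : ι → κ) (a b : κ) {q : ℝ} (hq₀ : 0 < q) (hq₁ : q ≤ 1) :
    ((Finset.univ.filter fun σ : τ → ι =>
        (Finset.univ.filter fun t => u (σ t) = a).card ≤
          (Finset.univ.filter fun t => u (σ t) = b).card).card : ℝ) ≤
      (∑ i, (if u i = b then q⁻¹ else 1) * (if u i = a then q else 1)) ^ Fintype.card τ := by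
  rw [← Finset.card_univ, ← Finset.prod_const, Finset.prod_univ_sum, Fintype.piFinset_univ,
    Finset.card_filter]
  push_cast
  refine Finset.sum_le_sum fun σ _ => ?_
  rw [Finset.prod_mul_distrib, Finset.prod_ite, Finset.prod_ite]
  simp only [Finset.prod_const, one_pow, mul_one]
  split_ifs with h
  · rw [inv_pow, inv_mul_eq_div, one_le_div (by positivity)]
    exact pow_le_pow_of_le_one hq₀.le hq₁ h
  · positivity

/-- If `a` has at least `e * n` more supporters than `b`, the total weight of all agents,
with `q = 1 - e`, is at most `n * exp (-e ^ 2 / 2)`. -/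
theorem sum_weight_le_exp {ι κ : Type*} [Fintype ι] [DecidableEq κ] (u : ι → κ) {a b : κ}
    (hab : a ≠ b) {e : ℝ} (he₀ : 0 ≤ e) (he₁ : e < 1)
    (hgap : ((Finset.univ.filter fun i => u i = b).card : ℝ) + e * Fintype.card ι ≤
      (Finset.univ.filter fun i => u i = a).card) :
    ∑ i, (if u i = b then (1 - e)⁻¹ else 1) * (if u i = a then 1 - e else 1) ≤
      Fintype.card ι * Real.exp (-e ^ 2 / 2) := by
  have hq : 0 < 1 - e := by linarith
  set A : ℝ := ((Finset.univ.filter fun i => u i = a).card : ℝ) with hA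
  set B : ℝ := ((Finset.univ.filter fun i => u i = b).card : ℝ) with hB
  set n : ℝ := (Fintype.card ι : ℝ) with hn
  have hn₀ : 0 ≤ n := by positivity
  have hsum : ∑ i, (if u i = b then (1 - e)⁻¹ else 1) * (if u i = a then 1 - e else 1) =
      n + B * ((1 - e)⁻¹ - 1) - A * e := by
    have : ∀ i, (if u i = b then (1 - e)⁻¹ else 1) * (if u i = a then 1 - e else 1) =
        1 + (if u i = b then (1 : ℝ) else 0) * ((1 - e)⁻¹ - 1) -
          (if u i = a then (1 : ℝ) else 0) * e := by
      intro i
      by_cases hb : u i = b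
      · have : u i ≠ a := fun h => hab (h.symm.trans hb)
        simp [hb, hab.symm]
      · by_cases ha : u i = a <;> simp [ha, hb, hab]
    simp only [this, Finset.sum_sub_distrib, Finset.sum_add_distrib, ← Finset.sum_mul,
      Finset.sum_boole]
    simp [hn, hA, hB]
  have hAB : A + B ≤ n := by
    have hdisj : Disjoint (Finset.univ.filter fun i => u i = a)
        (Finset.univ.filter fun i => u i = b) :=
      Finset.disjoint_filter.2 fun i _ h h' => hab (h.symm.trans h')
    classical
    have := Finset.card_union_of_disjoint hdisj ▸ Finset.card_le_univ
      ((Finset.univ.filter fun i => u i = a) ∪ (Finset.univ.filter fun i => u i = b))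
    rw [hA, hB, hn]
    exact_mod_cast this
  have hinv : B * ((1 - e)⁻¹ - 1) ≤ B * e + n * e ^ 2 / 2 := by
    have h : B * (1 - e)⁻¹ ≤ n / 2 := by
      rw [← div_eq_mul_inv, div_le_iff₀ hq]
      linarith
    have hi : (1 - e)⁻¹ - 1 = e + e ^ 2 * (1 - e)⁻¹ := by
      field_simp
      ring
    rw [hi]
    nlinarith [mul_le_mul_of_nonneg_left h (sq_nonneg e)]
  have hexp : 1 - e ^ 2 / 2 ≤ Real.exp (-e ^ 2 / 2) := by
    linarith [Real.add_one_le_exp (-e ^ 2 / 2)]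
  calc _ = n + B * ((1 - e)⁻¹ - 1) - A * e := hsum
    _ ≤ n * (1 - e ^ 2 / 2) := by nlinarith [mul_le_mul_of_nonneg_right hgap he₀]
    _ ≤ _ := mul_le_mul_of_nonneg_left hexp hn₀


/-- Sampling approximation of the plurality rule for single-minded voters: with `n` agents,
`m ≥ 2` candidates, preferred candidates `u i`, social welfare `SW(j) = #{i : u i = j}`,
an optimal candidate `j*`, and a plurality winner `r σ` of each sample `σ` of `c` agents drawn
i.i.d. uniformly with replacement: if `c ≥ 2m²·log(2m/δ)/ε²`, then with probability at least
`1 − δ` over the sample, `SW(r σ) ≥ (1 − ε)·SW(j*)`. -/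
theorem stmt_19 (n m : ℕ) (hn : 0 < n) (hm : 2 ≤ m)
    (u : Fin n → Fin m) (jstar : Fin m)
    (hjstar : ∀ j : Fin m,
      (Finset.univ.filter fun i => u i = j).card ≤
        (Finset.univ.filter fun i => u i = jstar).card)
    (c : ℕ) (r : (Fin c → Fin n) → Fin m)
    (hr : ∀ σ : Fin c → Fin n, ∀ j : Fin m,
      (Finset.univ.filter fun t => u (σ t) = j).card ≤
        (Finset.univ.filter fun t => u (σ t) = r σ).card)
    (ε δ : ℝ) (hε₀ : 0 < ε) (hε₁ : ε < 1) (hδ₀ : 0 < δ) (hδ₁ : δ < 1)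
    (hc : 2 * (m : ℝ) ^ 2 * Real.log (2 * m / δ) / ε ^ 2 ≤ (c : ℝ)) :
    1 - δ ≤ (Nat.card {σ : Fin c → Fin n //
        (1 - ε) * ((Finset.univ.filter fun i => u i = jstar).card : ℝ) ≤
          ((Finset.univ.filter fun i => u i = r σ).card : ℝ)} : ℝ)
      / ((n : ℝ) ^ c) := by
  have hm₀ : (0 : ℝ) < m := by positivity
  have hm₂ : (2 : ℝ) ≤ m := by exact_mod_cast hm
  have hn₀ : (0 : ℝ) < n := by positivity
  set e : ℝ := ε / m with he
  have he₀ : 0 < e := by positivity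
  have he₁ : e < 1 := by
    rw [he, div_lt_one hm₀]
    linarith
  have hnA : (n : ℝ) ≤ m * (Finset.univ.filter fun i => u i = jstar).card := by
    have h := Finset.card_le_mul_card_image_of_maps_to (f := u)
      (s := Finset.univ) (t := Finset.univ) (fun _ _ => Finset.mem_univ _) _
      fun j _ => hjstar j
    rw [Finset.card_univ, Finset.card_univ, Fintype.card_fin, Fintype.card_fin, mul_comm] at h
    exact_mod_cast h
  have hlog : Real.exp (-e ^ 2 / 2) ^ c ≤ δ / m := by
    have h : Real.log (2 * m / δ) ≤ c * (e ^ 2 / 2) := by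
      rw [div_le_iff₀ (by positivity)] at hc
      rw [he, div_pow, div_div, ← mul_div_assoc, le_div_iff₀ (by positivity)]
      linarith
    calc Real.exp (-e ^ 2 / 2) ^ c = Real.exp (-(c * (e ^ 2 / 2))) := by
          rw [← Real.exp_nat_mul]
          ring_nf
      _ ≤ Real.exp (-Real.log (2 * m / δ)) := Real.exp_le_exp.2 (neg_le_neg h)
      _ = δ / (2 * m) := by rw [Real.exp_neg, Real.exp_log (by positivity), inv_div]
      _ ≤ δ / m := by gcongr; linarith
  let good : (Fin c → Fin n) → Prop := fun σ =>
    (1 - ε) * ((Finset.univ.filter fun i => u i = jstar).card : ℝ) ≤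
      ((Finset.univ.filter fun i => u i = r σ).card : ℝ)
  classical
  have hbad : ∀ j : Fin m,
      ((Finset.univ.filter fun σ => ¬ good σ ∧ r σ = j).card : ℝ) ≤ n ^ c * (δ / m) := by
    intro j
    by_cases hj : (1 - ε) * ((Finset.univ.filter fun i => u i = jstar).card : ℝ) ≤
        ((Finset.univ.filter fun i => u i = j).card : ℝ)
    · rw [Finset.filter_false_of_mem, Finset.card_empty, Nat.cast_zero]
      · positivity
      · rintro σ - ⟨h, rfl⟩
        exact h hj
    push Not at hj
    have hne : jstar ≠ j := by
      rintro rfl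
      nlinarith [Nat.cast_nonneg (α := ℝ) (Finset.univ.filter fun i => u i = jstar).card]
    have hgap : ((Finset.univ.filter fun i => u i = j).card : ℝ) + e * Fintype.card (Fin n) ≤
        (Finset.univ.filter fun i => u i = jstar).card := by
      have : e * n ≤ ε * (Finset.univ.filter fun i => u i = jstar).card := by
        rw [he, div_mul_eq_mul_div, div_le_iff₀ hm₀]
        nlinarith [mul_le_mul_of_nonneg_left hnA hε₀.le]
      rw [Fintype.card_fin]
      linarith
    have hsub : (Finset.univ.filter fun σ => ¬ good σ ∧ r σ = j) ⊆
        Finset.univ.filter fun σ : Fin c → Fin n =>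
          (Finset.univ.filter fun t => u (σ t) = jstar).card ≤
            (Finset.univ.filter fun t => u (σ t) = j).card := by
      intro σ hσ
      obtain ⟨-, -, rfl⟩ := Finset.mem_filter.1 hσ
      exact Finset.mem_filter.2 ⟨Finset.mem_univ _, hr σ jstar⟩
    have hq : 0 < 1 - e := by linarith
    calc ((Finset.univ.filter fun σ => ¬ good σ ∧ r σ = j).card : ℝ)
        ≤ _ := Nat.cast_le.2 (Finset.card_le_card hsub)
      _ ≤ _ := card_samples_le_pow u jstar j hq (by linarith)
      _ ≤ (Fintype.card (Fin n) * Real.exp (-e ^ 2 / 2)) ^ Fintype.card (Fin c) :=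
        pow_le_pow_left₀ (Finset.sum_nonneg fun i _ => by positivity)
          (sum_weight_le_exp u hne he₀.le he₁ hgap) _
      _ = n ^ c * Real.exp (-e ^ 2 / 2) ^ c := by rw [Fintype.card_fin, Fintype.card_fin, mul_pow]
      _ ≤ n ^ c * (δ / m) := by gcongr
  have hunion : ((Finset.univ.filter fun σ => ¬ good σ).card : ℝ) ≤ n ^ c * δ := by
    rw [Finset.card_eq_sum_card_fiberwise (f := r) (t := Finset.univ)
      fun _ _ => Finset.mem_coe.2 (Finset.mem_univ _)]
    push_cast
    simp only [Finset.filter_filter]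
    calc _ ≤ ∑ _j : Fin m, (n : ℝ) ^ c * (δ / m) := Finset.sum_le_sum fun j _ => hbad j
      _ = n ^ c * δ := by
        rw [Finset.sum_const, Finset.card_univ, Fintype.card_fin, nsmul_eq_mul]
        field_simp
  have htotal : ((Finset.univ.filter fun σ => good σ).card : ℝ) +
      (Finset.univ.filter fun σ => ¬ good σ).card = (n : ℝ) ^ c := by
    have h := Finset.card_filter_add_card_filter_not (s := Finset.univ) good
    rw [Finset.card_univ, Fintype.card_fun, Fintype.card_fin, Fintype.card_fin] at h
    exact_mod_cast h
  rw [le_div_iff₀ (by positivity)]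
  change _ ≤ (Nat.card {σ // good σ} : ℝ)
  rw [Nat.card_eq_fintype_card, Fintype.card_subtype]
  linarith
end
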